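/- arXiv:0811.1055 — 5 statements merged into one kernel-verified Lean document; each statement's English description precedes it below -/
import Mathlib

section
/- There exists a 2-colouring of the edges of K(C_11) (the complete graph on the 2^11 vertices of the 11-dimensional hypercube) containing no monochromatic planar K_4. -/
/-- The vertex `v : Fin n → Bool` of the hypercube, regarded as a point of `ℝ^n`. -/
def toPoint (n : ℕ) (v : Fin n → Bool) : Fin n → ℝ := fun i => if v i then 1 else 0

/-- The colouring `c` of the edges of `K(C_n)` contains no monochromatic planar `K₄`:
no four distinct coplanar vertices have all six connecting edges the same colour. -/
def NoMonoPlanarK4 (n : ℕ) (c : Sym2 (Fin n → Bool) → Bool) : Prop :=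
  ∀ a b d e : Fin n → Bool,
    a ≠ b → a ≠ d → a ≠ e → b ≠ d → b ≠ e → d ≠ e →
    Coplanar ℝ ({toPoint n a, toPoint n b, toPoint n d, toPoint n e} : Set (Fin n → ℝ)) →
    ¬ (c s(a, b) = c s(a, d) ∧ c s(a, b) = c s(a, e) ∧
       c s(a, b) = c s(b, d) ∧ c s(a, b) = c s(b, e) ∧ c s(a, b) = c s(d, e))

namespace CubeColouring

/-- The colours of the edges whose direction is one of the orbit representatives `orbitReps`:
bit `x` of the entry for `u` is the colour of the edge joining `x` and `x ^^^ u`. -/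
def repRows : List ℕ := [
  32317006048384782300488989824004281131117346433385339928437020962319476804537190823039278471107587664631701192944760825052879429875512537891603932565522826704132524567809174861944195830231000679152170412771415579442722076303379712375618658519303261513361682682186592106127812764688949209289222686137688825860848679928843641036403926027745935712623212932214848937274720292263781824937599516025692124158079205131326783535849684758009339055551576845984865275253241722304656243764767940919478709126622378935422427538198456942911996714370728276766918175829339262565583215031811889343636185548658569252705542606664366832643,
  18987738187385139355881147796797182504709461386447212927127922466649624054940229616572288692782493124063483408613159659501532903014471537039305286346999101326608669645330572511249499111697737741474470455717602251336778883930123957280958005347462422610563253581361160400736894069362177894989366252039433385482080676739155020028690445142814993648292425170344585667951803832847226585972754692423916942785746039460892411784152838945826249905695285286028785235283338658425210660972202663461717641378857890161065269961171452533983693545220831336962616219134964586600570210568494705321988206434551325112531584958888572160415,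
  16347071888155008245826564240952269911133797979613272665750313966622539310250500893724636026378628191711089192182345713629267155809861400569463056272988980966723260238394449202483250505317567748828442131442201521623370680166320752933950385018747866144547953024197048633920354611729221988077794592072606424024995016904080351560637065597289588919532869303530278565271597547246659715776084185191730932272291874014723587108892542189549241247938934194675409530082555877364450097130758624818639643443410770559556149769612615628985875404332016744324271690291598792500885695223761940496003700901531790981257150654450535334375,
  16802752365810713582156436342265490010482059290439137899926506475607115856556273071327053206193144467712139735360338774440667514691551309729907572160040963205447339671555521228369205637558499197147167277501445996689354227248845523946024280393138376585895970410190248438081636142197384463329617996525662616810874346478852280827647147219348957886829761302478882184086862508715950491199609125705429590633243689139602049961523752500441896778760851965376853226769376971586114870706130030997049485749497981333062322591648633345388988117322287176050222681425394499594939125517280266042410896275589897204997249723577346918174,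
  18583872744916071216371411831257386831461904422753171886495076783253017649658039390927112454276142540814956240689773978911024109446658846031973756867387577636934448825337451667357329425160820286997902412563478565568172502567940276461224880078126280532760372227761506029894163001658909662852686749122606899173423918225672481578695092924446036083401519940192460252155077675023637099662280181903446582179348003323744707731404855399329254917843437049703977451140848865899652218546900569984126972360281799459113690586058517046767354965981732563526188652835264474264040881951563426122857415305025186530225849970628489761070,
  9571746804318685979977649182228494382762407437127023091193528254558707171918874367742144487013893547068667976305371372760418437232563730046273679460891389693075718722859305776862218166674447050142417594328256258174574623206062853500032988404370647495399715124113617723785433838352275754614402941118484200022140704919256401082699807878934133758421527114264409068915704251103724673946386702717835994264979891830560746703264728708944319501337500368407983850400594761841276053683378760537033989418346147782533660139291760303455332740250502081234210805932503466929471672716971926530552351265149783735350802260011561635443,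
  13616397337263105153123649751492674064816636166136098081825193869529278513938527537508297373895409275770054790464264205086868419175482422112013912585574544926711783341504148876309121284472382330734699466898157502294372613129219480403185300861473758322601932196661099717314958228392872647887967217054745128655944743495157929916097708628325310914508865376966098857767022065150687236328523272063661966425512311497938291817141789223403485082403112162724961695429309323178715030845788252396438840061850349820809619882686376843352577186481384339161519957520762610826826175499899559371436853126672756463239312163707299873592,
  10173322298151039031294243624461993791144831755049085490614755405448390778163879805624498953102665197364194897241274476417369447546117504666720495492964598748647463448542884204171176165168921675747710805474241682490822246181844589337333414254984220140442371278682646634274760436238531179863850689384114713389468570533842320616255720881854893622221817164073274010107413982480115109651979497956991978762130171575942494999748455145181568847009994454674135035607721976171337826888635604463580319958682006569324404786399816594574771093551290685018115394285771535136962864081792118914257950115886993017061532825473701501629,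
  25573932692018963974012661789440230119962569759988282602938856722731959197013886767882713183983443314784290191228942239369898020933824577937222269604188181420800529966451274348715364280718343439281058854140639315533222452453865581777409678527011896990163630204744420319997264533299131447628412971008502811933784602454232996153888738933130219759709319183026737608334522495652499251718724526013624318287227478443083623074306692657110983750921520706598061251080408445535591275827128328862983021544717664516628338561452548385077786947647496004166099972701316903700447273008924986106608998756541242468303942334568740995900,
  12687691543316516601774367734506603559539989447431231396984276253354860096629316910274889131475732488736844139111907526795401322900314081299441293079896974083136518656067226559181657248338633669722740947714160806310193251966584621784985784569515603579428695514567172602002598437212956640366709369640164563114473515412856332931635540050318859847765728632503588998345354725344256063441774271966772017959378267546650387397776716387815551436256536370213481972752571911436322977422004402245107266196634874267637140690731956840497217676993097022550336377000128014354962904229120967248662366112178189471121876063730276919016,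
  13769017320358164227104149655304199001048748239053703686324750583779667697148480511862629059278199476645675604206066064558106716386758338494028356374946558407354758678386054296206959915684109669491321704207873887581023072092549816074398592570189671021224512494595919859550855850955269809158410466322307486912323751175685873163010263447593608752017704831518895702311529885923367124450520582683410337655723873445893649145241923187560022623209708709617118106917105439372678299287593293646074630920428592809959721673462832544104060626410163508051767733667343851627051759976225371170115924496541444910850587749817427147308,
  13360866181792148199390309742132520688617052660396285823310829727209659724764385563926099478758919305341143965803474504471315672996739061887739456822584550711005727391193018222271774382128153138482370443608364924913980826653861634171117087679391192421543366937587422954161486879834800625101703656987380199730913569485588807544364411105482438021839541327604625731385861763626108206981709312054259769475574789225752528311694851777274009764733194430385809432809187397670638457477452927026917842034563953674033307519736281164543832263037398810943177916605057983790817009888938013059554035600663119969540237092507222475388,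
  13453041815741528365770518987869643654506665276201920520476984532069866639201570213158039479090897277832885452690202034725105361022742829608840947376125346477606582504980778296468324329177352116967319884573453509074668266958977705416483307678510725542485215896224146822074251639307966560462729345043378453239059590596435588966192228171296207744427722717641094449013662669906845829582229181716424580434422331399593158048033769547786303246055386801161735566938687010193879845969779670801073345360049015381545099720333467994101872612632922589761913415807256167458921994746047910650133712574609316850918212593344379777708,
  13212138679916750019375103263228662692214570416129166174064190886272610856288486470929995829535444475982660402246931473478085864386187289523439903239654449588084772661210626565636048111346536666159828563528265667554116075838996733389475275925563657263598145066141075026576434821568679397796852998641760134189423796568135984903772684663628982729785054552893930910260119076875131674858500654359272535021863688265167672986298651382977214909618679097362527135150806275072430689729448661928998845738307734812188044828210799399040823173695538129549942620923623224270605836429677299479829530576959551299040486779416923664106,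
  5176582200291477914267338866626569359279052855263600375187286235631402474585289022532940466174947618977893293520221409348599149362013368168528830217220629134554526391467134621090045490389571414738180934530961346155200539362191970056545267204892901306753825429433313792284338532985788461489736177991291371037836448766231628307413038174605281588625364046430609414008712651135116078034056121894901564526487598731405335166302117153179196846103671790198007908758234095462965287546790050238445388215917957927703380567118307381632934890660935624768335956747783967989729048453322107149997932089249248987085512034309188776544,
  13444987465221900375847668621768706413559179167592777538076380738839210877232431214116758764483899982741812340032389691902685229670821995434341909297853287617310529747196179177347629451584875520651637221293674266946745952481482953405137798018245990712926202170038955226312668678734753270329842704430204497664878547995965645238106655360901295296202803521406675016302878731087189579504367909420368609647069738332891448183145133348235750317502018235636342246903871767472374930943304157731634820640266119868811412767642202858534883211221992586251426044922186155662696977866644510272167326122377522518148177481470838040232,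
  5122768716673021977270213629078000179685270170897128346618188808962139156955207788349674684732575109032488730010200068540638159944854965770196504265169241343574458776428746111638253066072171765466267625796978937571215891489477879992169856457646325785893762950714513041272485590000226106978264707855033418342663872528467909434549991218332180455831612208816065700858149604583542860276167173201688772388762003924084906816072258927827213603039216763257879942871399501265586916278423224837130533615560631949048382030727561533581352604471919725178223360403507090584737253733022862370578679970832302147500688050850003991656,
  13334753848982307090180308608943740638247005623591834712595651889666281721630858663600510177429159279448250083393384635081967977186216217413382266149754439766859934734487002972429489250122371267408139298935170580885946675564777480209438506322986401177165586224344923647628814797075626163627845302111914842993176231186404267646496085933610017269437323487590674545885039243428063798758618528285615180118135608376187229529870315314101320411660555354937199435169767838207915916811012832946904686026949168477934194907684452206865976842049533561543941013433601359531279448890354016795755343174095674640316702170932776558272,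
  13200550502489621747266472683760310471904531321332659603513957943100720265350641338166233699638413109436478952213573764456584354139218380306426179781983494798217478234170888525864630302893061179752694182840979041995246042751651065594479948824301332984377591220360585223501982112789426424577503268682221951059326279419373533183802098670858032554274673919165341796121227834381245184477741006252873074089163867310151236171314179899698494214140954958386427170456564856010277544443163169298720520300970192533671375183474050684425335301163853940290159407529065469392347217071117763588509668089698771694178038778324018696928,
  12206411604139537972339214951699744584671241742688316945806983039070612176652917452148829540287517263131179898770196568277513294154714119669292729467486708888864810930482823814322501048973029015740567271261216785527592883757014007601108055755178286122420850856974825261159227057000112131274007482568059434603120156876933149248180704407967318527736437463689790915214737305723632144346230215182640718239348798290760497866194068162380365519383539652722882953960122801824874399830050684743865988054094687462450399626043957019687247798452465384699689080955029672363101312025631295983287775629492579735158954094983330042472,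
  13328272085561264064979607173759005445620872558371284456699738132888800926182841299167340364244815093142447038861497332680323530108704818977762385993310961039629524590739782799108709473778691148431393562707313335652473244948578108051769747557774825386784863913341569204492110173923820093061761596514976050148764682606648533534139154258051707758004841235628103862967430644327305045476512992794093469222241636332982653278483731786930388542134238057397682282876484784428721900923792178801799000966246242103322324237013340065096907745455996510767492305860336474127526138883241635327648505888525909155032055534027006189176,
  13206082689747312976391023438573471773838765717843825640492732531352837669672029960950947660601157083897073480662103621706018036573054530184812557271171776723134025664410196275641910839768095557582295367851564611600639553183921691967623633008380476784094805970010957144270948521484039550967969626193782490612244064689753617399727945364098486050531144544140954681609791055879319472157075627950407817041470693138870313090780345448825109363017027473443614480663761176738430628250354747412368978009681701084480489457896027504232101671539184925499929883196232650447775158797397248161307716634618285580694732001909464356400,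
  13572369525769245149309150865228106802065942644742502042032762308307555177905339533983053776653795516817462615328745163464759795463448611318019081252685704469310410372055311609055484461067696206361874321267067845963363428692324674517302081563872308591031069834784474743450229493939726141470134288404543686721712023004016551671696278315858170730200391972623207461083698275552674577596574632822968201161927809837529877551090405366476720971933438856306334839750795674060774973789835109726017516629761757467682151215782819867314559014864982457209335909354355212950174544041115757098431143673500257254697608175671943536297,
  13707010060435632055407427600191929631307717209213596115109507656498925941970247632679984836557613460143038402862878858631009176503037305131891324189207305333923490884889920372866829250604884015086767482524196917231232334782853286137434320098226997857967261164214100541612684553571495101581033132828113731404448986020147069308999896277984451624356060511089895818083402094984431132431717369499659994248171322825693089380953818322949083094239427719472143956361278116445621950638648976023768841168711140820650317277526568677889510728043909850103210086487695075004721027533762379677034581674229709991932176586384271121129,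
  13201550299066921860909633731845221821632455926648986874511817759697369136268967076786862843396631063400976428529258646081077133601562129831428106465895138176821612847636431815285879374574911531474199479268870614482148092139931285751941611139529339729144773497009046395210330747963514083210089773489560908423530586740613075809138657150312727524320020893862076798622653406275204629994168733030175125265055473211316321072182435663545586101745120101472249971713000859151262441602819023493749080596648721478489907664102661172235157610485220912673738998639320385901306934546971541932608918718452091976337438722287248139370,
  13376163026267977643792639922019880303242083614530942116238331662241179654789476948715142972373091473403052812486791917599558791163365740172906860762588066814413356781478497997505188354252249254186791968047412909844386061978638937170438971960419696797636880343755393995829109145736461111749146158419595468260928137340859344173575292130653908810579668280967290460009254410626264338308151847140313832133070035662104253885052324393521772716432389244743488805947301630956562662892706330447801557843842609996990490651983152602493082340236420410322451552105995651701345317654051395640345476356962304180831372904108646077641,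
  14108990977462581060777569880274669265862578868759719978254172202874306146361866412674933074301839378238753673679388550413250476624742492409060597255623160630514061999221859707508609534426331418735567907799703933235618525558482972983050085597319052390243907099273749094208321990773487508974449348299891544981615494714853083575543578605567550917681321019033930604254729196825936558634228663617593353409244744336560410030547146855648429275222074646553094902811155285742613080718746633374116370136506167760109164586586638962074749831683347932838038917160486051335094215780182219269929540936350572861381021574509895767016,
  13205995520258049285726455174668241006970455934573192207752499492213759457239284632724872100925809317748695443032266840797243271639841685853627420257663124746953369796126717596380510169230200702882175665147351118525598348407859593480864771366208011938055318054034885948906495054295786174907549361363114072154685840405280984863105338430261045099587547161679909936007911198536223534573712101596913221990372274070531254419449052431347591046937729950928356018248226324761522114171327257771315434362139502064395313016399789182020979316679166470177404828712734137359499546167532795646254706429902891623161247396643808268393,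
  13202541790905144858781761539971635523297606848300803456413784623411350864722237073227456388964179246244362658170052339252654579934464056729749447455638782804714905558323549401413361823761873044481603319920277408007011440926600512936958586817761067227049678215044092036737414817088356893914639957435003946207632203833349397056235234680173955029682507122660032119399145838492906137851153098077365401659912663943426865176226363100433663997998536376728382637039178218024202272727978542259223380432061739802258023601987540217518909830613249052309215317747791545009197245112794648431266841454469047479329137455292160024168,
  13762767142532874270802622249384659771803193654736247553221297068080071197500045413922507818570755039989983738568659070736462293660396801258538101084102051500629042370828412232806380779199170811310233051935333275654675736756652957376491230140811308595284319962187153625544127559263378048805850761607833621172762509292715555201684116003168761047272684976953066774711325284789438220316159140024273071852518367743011570491705035188858890874768319864564174203298867236163808522691786314627267047653776633297011612515276520662110330895005041779532738197317366662784693458171332465217511932101884804477434153941918592202344,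
  15171251498131179734946202820089439596894006186680662831177721352429907480994907242866089206810637447952196988204647475005676067299477199879970733152886279409465926225078787262412473568579810283468707980015398871156982147631508039984547691861221320748238878966428553981248887867584981617851735994676260397544940954306696355822307465530881505711842363120357222812354840849061051593081434359898925981668442192662822151674688400112170164510065453754886068592327242412054191738287996199482990068947827016336832257961992590698865320823962995468626330655926277599757681139290883774227357837496723417696500409516688137435720,
  14211501944848865589676208992430593966976732864438851699239994733773782453287168748775213719581774747235982991855027379225688725867264163615605035084469294155392889638255760198880191404683064194324800354374114755830608471933963615978898669879449217751710325081916000879069187102931043060270964143792614424065219140756817716334577338124148964278552964629688995134297236331034445694307370173655230867706318825006950829943067252864443746871814617870792356802900393532827379244987260487483404262811389866089704846634983132626114673638108970524651012455235195871682278502301587804625625083424067210393210331432153917921020,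
  13357385420805014900007184973107055005194218535416163447875824717785883099415645442281962103948536303849514388768220146977337447578602725729216779362325997878416004969878735517675497591356294252891921612319045284313620194051561669365724654885897699845367098354094796689464615882397820340371594716283219005775322542474778206133709177596023582365381146056162457318580999797067791002398411972990085147048494665793350189796979771409283052764767499667997462713533065641608932509852140888512009275628841180337935891638725422660348965528074383010058588089152936925776047578705862394716132986943271364309068829138491016116208,
  13194648221878601558625052590787365965579319746000080923901213647239428967057429591716748199492481996210314080926164149960956755787614109602746709992408076060030551060466998183051277424794648104790277023070572436478707132850122688688756349855804590400127020426069770343097309585658847252720789275076889887395010472344389937399140105648346035152868786870599949860787526475200199937772208845262927104542387085968602828452582068022780744072030656625535352850955464865569997980241183308950034354562655113279130359741224634420237297170582153530227503970823909630114165182355087678677594970492040086753072567060532108739145,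
  15490609387890383461507576123198596632743414836623750536079297049020492354580171054828695708401226290199077650822098628524826727445936575037560450756765198520333672492821122384105605395631762924814297806943423254071153044800790373917496815140785541763347203628763715599269962676663956587619414518031556474711356778802264931355755139128811011178549515651280435390833834220933284584357045330428049378807532228085452475495584756390073348264085859077093589210937245173581325566785396791426279634709041865460541096398872976374907156953302505910858562032257803748784811123465705872267112215068497691473567881675798968800821,
  13786367507206590876542273859554043486491080613219481857367845319784681890977138862382337131262464288074520085489703231170025414647445107157472145585773121077856383241467455774112539271869996441565021654917363556933638510231025061121254322437796157034144722790072765498321594441056479447594908255641747722146819312373653185466138181505799690530724804423878224387074104639834441080739597175627269513575370002151398947242493377543943420835246993705102892287520903424230936833463412455881594972239491578022966468353795887622507597054822810703898769063518076742875661032130040402286967726263492451208645675961670121454825,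
  24497099359835308721432422541456033835340272375287684457454535699270046220384068602729025023271932968095146273929099200986088199759401415271545897108408576260941366165152969092632998269116639781073456175968243625219654530681755942622022281409952377556455758529294087784632898017597621973745522161345229296939000282931463670569863107335790777856595699622622770941376604650699679430863875244886256503535923994687636294163610981935554109267135054211268428092526132288874207353147860866993794236282892672479232673348127545304940419607580499768677033748258512409327743808672047180848381861173153736857616670896674308239529,
  5304766170945366728210722557803301347905577813362912365917901441440484998729214236895837186104461769262968440445253114686519746860271398645800832334307795985122958235725503791008059690830560685366489042773969293593582536971153521114833926885660820874508649061015588792889631921269822941818800422827049714139909868114977753081382365955173553486901357361233245824457092480694677018243293554544643437378482175614717593391235358014130406872120380962425073522631964830156255032885347751432560649944191408286358795327062417145610531940088977358466840426252773793207981987592627606783607269083582294266327034500769924993635,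
  24272065666062014481365767737570657452190580935122355879716440116961186577278187038508557536416861897222189311649841794533994111390134317907473951745655893341008475808159069174821991494194480060083135354814591505886225194061225342740051957981180438306487486037008147442714341219525622640885592222577145272576773460030529142614411746995712383148428179711556903706411294590552403812620315339142282702384559330115964593452733805082629417848074731799418344687596353679313557346978005996330778163570548547185207932549727381584683786161993774643774154325825676545349621169672501760035308229771983292688703965375246353709217,
  9885812155260319191347668021697390950053186183715697786688668613461957177644789447980971304841646004521170959577724005233479222408475586781406816802229921384398533279564214961497975747597102314873951908923664355211988635147111492997579880940044332244913272677054669407096030914181468619222429897522006905683932696483002448155586364661571304279907564938909208376605580458482299077940335475638885142010526796396612249076460809762163735250008951850583992686328956383834126635377580959410764455305146565524307790291368459744941392658239476206126603112606500810307111815277939280712188902809302003068835715166332779630665,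
  18988718622810043764140185950831580310964723705755106947880067260299039417035602068902401161388012668811306973469199758962928456756903379537296316610852692199109821037524527134780901845280254564772861329191420384524192545301406511971071131945480752026181154818544328300216956942014729048370882946022639586039666072168066921669940907453965829240515649669059939364763741102312383887218740990367961936759997065579668795900684912927990781477477172706649902499753632280155083848781055206919451499413189734560973975229796377938496444694781515381083872771487994499564189092923897623491501118075046987479307541613971946801559,
  18998122913116201138558175327926327624616650044459742286151535227704563587113110196820104121215279068555895936341411344437979386461586043127512356771960179587619825270979023178203793481234724316332361582384208471010489917886601701839167276758061925996410626976452536611955301640606202357485859741390532537369494107823176196237999456693091321851370957093323036914904761570353051789939486953682414582802224298435160648005161463963932286477970766541446200166765388166847548985477066469382429220686671115143387652961832537394687512779465783063015124357017805250803512313288915460990858141595672480776557186488783336235286,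
  16168402754984148091652569026367651318274304329560068985836320638483248337855384760871792910704287278041470459984237492770113258891701030541591897788240299209780466560253455357745442694594545296303802601277933722790095306526601005844556179381223034630004609788177422147838160260570593163512192909617800223591681951877893672775351272738714376473428886159232795867668144654494899593322316039010534383053523628192107505681197394021303783930025950416614768545350240278374385236477237373713079730277895831839682135978275247289100790448798758325341072725818399540944616497115658636038635564548203525310776688824179250178049]

/-- Packed 16-bit codes locating each direction `u < 2 ^ 11` in its orbit: bits `7, …` give the
position of the representative, bits `4-6` and `0-3` the exponents of the two generators. -/
def orbitCodes : List ℕ := [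
  5617839684116360886972594672905595152607052141971917271965572320503950863209876164966823631564782183598483632576238952110664182994461038951147016858478604411252708515341824333254070065848308365728910450347127338831805318958663835871784480722497426349651368980717658674558576196699600149362580250618182505856,
  8777884651278528649363206477553444242940357941938927253777426830517994274106036974933260863827256186902189315461257745456804664237565112836157422415352648449112881913346133141012112588034897160742394721162396157070221781767578465546704097274585131637018429721505908703513275202993469952017962270773815345157,
  10182353842933487971079954695122653481985571381375201187491248208251711969397948893174675340755780726435992169440443533857390764123358454056827756377586454758218186171931077143560715972774454385282909651440297807532506610020312938635201392226141374579886746956155565775464038345301119272923403133653703983108,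
  12640164214447963238869720985877459929990647435992343424031336627536404190116764469390819875131746151084527260660230260408882044360678117854437876328109627133466645533300968734496947891942143570201791850863868085543608831415619632399876350978046011996444946236495604750843294377186868898248532833128285470853,
  12991286869759921139428541502345053319934076249584403883607216816652418546322402328544235848852227547001466858540548474608320982725094979148329911443178860282944735848185889169275142480980454964094883047941652044477438169144402100763503995115437699436716923023753636438469448437302174506230190249614562754563,
  13342409525683726340405561763746426207514248704666952163374517783268118151636577972290470239014396818951868009122756219017338021756242265332587813313691558189798096910559587711126143584687375869243443508534058476817911205893627767306243862752771702166795680100806116947176899096398548623839634155513149849779,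
  13408248371887511207284235594844018026498755548712694593008534300400821737425487815278296525927183571982386524960826540774680010343517075913032639342520122802888557673302362206027162565221013392042411917450390125238759498145465542249359272722256405994821031735074167305820206116489581218359465045165180452996,
  14044670909440024770768789742828021339489067009586890321965081889498709893919414700949545491135831942845745948496072828828534666447251992007951966233507357826803558933279275215100809758109461831102045109417933384579138256514868416657623723150038717878502734434253191973126813069440099993529507002989240713477,
  12088848130785208929723230801054599046606824493725183792687627164780487366055615050423163788655791725086488856028510975038776896720407421662816503262628008971721549895158735016770805526499525065926943527297158705251979402102477608076443959055939788916108262993741354847286257276864964474320881632928867549186,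
  13838946613668830637275573570136121861042606112908855494254743913505772593188300710020014009794411067541915866956966734368399202432797688437862680739290035861969745806594308598294344317766833848469771270508264594881636805072618095317363349439839048361038114845723582411424528295336064893977921425383415087301,
  12791088084546912506797390986147031704705216690236189983400529161097405329180495604791111139788721797564525020431126719520089857196178439119906822525832299442721789573527035788264668251261531620160324140366422371498038276812061995146155780123001494702517296508438475321308446293781177127463496496885712027826,
  14190063912105162853706476283940622115102648868126026721498342470149253335409901077195060024524576940158416434122033177952327679664814862337881188424636342655733945952095141595658462479363855867140071695356161105957774445162012994621096807050279107922032295710580390423414932275354115151607466096387567190405,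
  13893808398877564699814833815943522727155746492096023502336658613945862647111811903367567881069389500646235704898025707028659591906442201320864489928456961138179769692502275913773258716068802786722702176908929969611988690737515269176425981060453258442682140137240817155475583157407737466085304215267675668611,
  14244925697094838190801663301313243520249873676214638505887173825976795087507044954240255092348882826353281058398777424951411234915242157815667439117736212452478859777390985545839833746255037627946371034630044655956786106538781196448638059072164708397546523885533393868704096265282164157740143133713601069573,
  14110520470877423995241094857649994746828880443710567172766511611617528155115142279829281573499942641721890914966650690761353995257039512672846944707791557537115279541109100343977779392131092375084929684836598573003971528577349982049769840824978138143950757716600580498741405698608741014828073998034120474884,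
  14395804280096727912343294070149016201798079484032646966355557778854771084909185664924253983436507058393207973312322382529623933547104924469226541763355058638004335809187806378608256040908180966472860914817033503079993056815417453217579221754085939713217650322949145249595721943561500426942415295282827035269,
  8780670196873868789493039377941407205417074607599543800417854964820216975468611495798361265038635766240627257114039323179623640673811421023424337138671119609927789983194628393173263672542288324947220432368015260288335177481759238219744768019300565616098157444723012733221524098695892584642595948500801880065,
  12642957336073661299799901560181522765715502915305069922799190405095704830733339045150725105234267073057082282164921088943615691239501726011407004158312793669996641034672883657989394155492822259830808424333608540227004890092462938545048970393062011252938243740248020302487632614348462370986804225900680642709,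
  13345198126260413265763376134068316509536249577165896749516413920962978109548704638915733992751708649498256931305200019348257755836730903388956724762448460670921094590315136648804539831994907484509726873635733680966735774434872128843187149113477377732865153201391292233287658006858564290610736470227881623748,
  14047431802060126420849308249883536166361957332769303070336085546309876949401265451896504067406797212846316713647790995724434131199749622261509018855805731771140154347490785054523617161342831106928873741109333317099557210194828222437925575505525954653041255274666081300008717221870142087809478513655398334869,
  13841654014870975038720473251083492327671193028049834454972610430413192649985883001495062843507712200492554762402779741393323528797865709977018970019549877292755804024080287199809272276463506805163367866793745822546878027650332660615115921774369987160168800490603584961192795796151176226881452279778248949937,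
  14192798100943944514546591809087198892739809628023181384426383809046283271637826314594611716678761037804161750873170171768069587313938473902297798251546374899136327479379408851263051026644750642161103818349890490356402810361104192894519202957601907971180170235610690771073037787756244966943606593207900635441,
  14247670893610511194881425528272229522962369490562600539192063252092191310737033561499691018617135442594875078052831797917635970663451050081801617703539218828304437251396247303183978909972495456857140449189096831611113028124805833679949957687978364039624346969365922615654718013829586755395745177796927029636,
  14398549100087709294428867344866776156407885720369730675385814206341809404420464670145199169297058747032959428300526289293562091548287656469554324143344685597143855005985515236480534366144209217988276826673188856717956011872014574915817080178615476628552839254923668668764242393509470129302968332405560378117,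
  12645703578678521625133848672029622837544552572581725481759263187981065106236815467408615966228905327462236603170460963035794892194632930074197679484951331017818944962610550903839193245895085777926745614212789423120854016883336537428211805202013429387835455892176397809689674372471657005819668728134999605378,
  14050175701107158394467908988840222702866873305970551074251902631728600980614671074369689116189078174265659352752530706162045550171289009470152464210507267818193813323818689588340008954166249437839370841730822922317120399128350435309453470856116110519597024824710775078398918532705624373543989137613680607762,
  14195556565844309689672880125071016579318484631002233732272437283014368981140483338480531775254822832918313609314899779287282410237765064681497862028492057892672747752844378377337212774890359623914468072688703580868043224727707561227359392091235112436402224479607500126381821682947750116453830476274526847492,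
  14401292999206910853679648697115488319334702885674102991477861138232776710551842575131136015897514677198991322860707986250754660791760768490959083179316191789673498647105581284670916550302472878631769046002501980247243258560833904417128470150051140189203738549577345376401769413897718105499562708643795501957,
  14052911982334442992733312108677669140812897948281447902603141484412159256980193664373070634843970155303555188147265440426690773190117427122493106015560385123182368618629711292302368187045351765498012774246958217472955635462936108129477440102228237617232858139930623562485511912884621486291030076712877752579,
  14404034010316445409754253017876513284140055070734650536836336301784604540759532614104966101201943112704936454605792265218625728547576415831134625331357089263646267722118546358594275331657820829380156420390904168324892563035154596742463041214214156531325559076975968037462970279705263104273410845859985556485,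
  14406777700184719973213941984089299648353626463865504934425436046320772054459138176357981931030717289592338679048296108957320764956744584106863525043290088410764533819678918967072019751627443354881954889732214354206697614303059107341583083534641204555041936182586318503747249500366031914848908727855540863620,
  14746921578097490434337262660404362773668030140832660844700547544928194623570892870463592404690712678812757054240857159357825608926649767835368319012748776852533828146197212105999417011960284052458182161826892667254616474451833942637813715136590099179743696611397072343906462855888227821542638783903496995973]

/-- One direction from each orbit of the group generated by `rotation` and `tripling`. -/
def orbitReps : List ℕ :=
  [1, 3, 7, 11, 13, 15, 23, 27, 29, 31, 39, 43, 47, 55, 59, 61, 63, 79, 87, 93, 95, 111, 119,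
   123, 125, 127, 151, 159, 183, 191, 223, 233, 235, 237, 239, 251, 255, 319, 383, 479, 511,
   1023, 2047]

/-- The rotation `i ↦ i + 1` of the eleven coordinates, as a product of transpositions. -/
def rotation : List (ℕ × ℕ) :=
  [(0, 1), (1, 2), (2, 3), (3, 4), (4, 5), (5, 6), (6, 7), (7, 8), (8, 9), (9, 10)]

/-- The map `i ↦ 3 * i` on the coordinates modulo `11`, as a product of transpositions. -/
def tripling : List (ℕ × ℕ) :=
  [(1, 4), (1, 5), (1, 9), (1, 3), (2, 8), (2, 10), (2, 7), (2, 6)]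


/-- `f n`, arranged so that the kernel evaluates `n` to a literal before unfolding `f`. -/
def withLit {α : Type} (n : ℕ) (f : ℕ → α) : α := Nat.rec (f 0) (fun k _ => f (Nat.succ k)) n

/-- The Boolean conjunction of `p k` over `k < n`. -/
def allLt (n : ℕ) (p : ℕ → Bool) : Bool := Nat.rec true (fun k r => and (p k) r) n

/-- The `n`-th iterate of `f` at `a`. -/
def iter {α : Type} (f : α → α) (n : ℕ) (a : α) : α := Nat.rec a (fun _ r => f r) n

/-- Bit `i` of `x`, in a form the kernel evaluates quickly. -/
def hasBit (x i : ℕ) : Bool := Nat.beq (Nat.mod (Nat.shiftRight x i) 2) 1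

/-- The set of `x < 2 ^ 12` for which bit `i` of `x` is zero. -/
def lowMask (i : ℕ) : ℕ := Nat.div (Nat.sub (Nat.pow 2 4096) 1) (Nat.succ (Nat.pow 2 (Nat.pow 2 i)))

/-- The row `x ↦ A (x ^^^ 2 ^ i)`. -/
def flipRow (i A : ℕ) : ℕ :=
  withLit A fun A => Nat.lor (Nat.shiftLeft (Nat.land A (lowMask i)) (Nat.pow 2 i))
    (Nat.land (Nat.shiftRight A (Nat.pow 2 i)) (lowMask i))

/-- The row `x ↦ A (x ^^^ v % 2 ^ n)`. -/
def shiftRow (v n A : ℕ) : ℕ := Nat.rec A (fun k r => cond (hasBit v k) (flipRow k r) r) n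

/-- The number `x` with its bits `i` and `j` exchanged. -/
def swapBits (i j x : ℕ) : ℕ :=
  withLit x fun x => cond (xor (hasBit x i) (hasBit x j))
    (Nat.xor (Nat.xor x (Nat.pow 2 i)) (Nat.pow 2 j)) x

/-- The row `x ↦ A (swapBits i j x)`. -/
def swapRow (i j A : ℕ) : ℕ :=
  withLit A fun A => Nat.xor A (Nat.land (Nat.xor A (flipRow i (flipRow j A)))
    (Nat.xor (lowMask i) (lowMask j)))

/-- The number `x` with its bits permuted by a product of transpositions. -/
def permBits (l : List (ℕ × ℕ)) (x : ℕ) : ℕ := List.rec x (fun p _ r => swapBits p.1 p.2 r) l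

/-- The row `x ↦ A (permBits l x)`. -/
def permRow (l : List (ℕ × ℕ)) : ℕ → ℕ :=
  List.rec (fun A => A) (fun p _ r A => r (swapRow p.1 p.2 A)) l

/-- A row on `2 ^ 11` points extended to `2 ^ 12` points by its complement. -/
def withComplement (R : ℕ) : ℕ := R + (2 ^ 2048 - 1 - R) * 2 ^ 2048

/-- The row of the direction with the given code. -/
def rowOfCode (c : ℕ) : ℕ :=
  withLit (c % 16) fun i => withLit (c / 16 % 8) fun j => withLit (c / 128) fun k =>
    iter (permRow rotation) i (iter (permRow tripling) j (withComplement (repRows.getD k 0)))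

/-- The row of direction `u`: for `x < 2 ^ 11`, bit `x` is the colour of the edge joining `x` and
`x ^^^ u`, and bit `2 ^ 11 + x` is the opposite colour. -/
def row (u : ℕ) : ℕ :=
  withLit u fun u => withLit (orbitCodes.getD (u / 64) 0 / 2 ^ (16 * (u % 64)) % 2 ^ 16) rowOfCode

/-- The row of direction `u` is symmetric, takes opposite colours on the two halves, and is
equivariant under `rotation` and `tripling`. -/
def rowOk (u : ℕ) : Bool :=
  withLit (row u) fun A => and (Nat.beq (shiftRow u 11 A) A)
    (and (Nat.beq (Nat.xor (flipRow 11 A) A) (Nat.sub (Nat.pow 2 4096) 1))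
      (and (Nat.beq (permRow rotation (row (permBits rotation u))) A)
        (Nat.beq (permRow tripling (row (permBits tripling u))) A)))

/-- No rectangle with directions `u` and `v` is monochromatic, where `A` is the row of `u`. -/
def noMono (u A v : ℕ) : Bool :=
  withLit (Nat.land (Nat.land A (shiftRow v 11 A)) (Nat.land (row v) (row (Nat.xor u v)))) fun P =>
    Nat.beq (Nat.land P (shiftRow u 11 P)) 0

/-- The conjunction of `p (v + w)` over all `w < 2 ^ n` having no bit in common with `u`. -/
def allDisjoint (u : ℕ) (p : ℕ → Bool) (n : ℕ) : ℕ → Bool :=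
  Nat.rec p (fun k r v => and (r v) (or (hasBit u k) (r (Nat.add v (Nat.pow 2 k))))) n

/-- No rectangle with `u` as one of its directions is monochromatic. -/
def directionOk (u : ℕ) : Bool :=
  withLit (row u) fun A =>
    allDisjoint u (fun v => withLit v fun v => or (Nat.beq v 0) (noMono u A v)) 11 0

/-- The union of `S` with its first `n` translates under `permRow l`. -/
def orbitOf (l : List (ℕ × ℕ)) (n S : ℕ) : ℕ :=
  iter (fun S => withLit S fun S => Nat.lor S (permRow l S)) n S

/-- The members of a list as a bit set. -/
def bitSet (l : List ℕ) : ℕ := List.rec 0 (fun u _ r => Nat.lor r (Nat.pow 2 u)) l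

theorem withLit_eq {α : Type} (n : ℕ) (f : ℕ → α) : withLit n f = f n := by
  cases n <;> rfl

theorem allLt_imp {n : ℕ} {p : ℕ → Bool} (h : allLt n p = true) : ∀ k < n, p k = true := by
  induction n with
  | zero => simp
  | succ n ih =>
    have h' : (p n && allLt n p) = true := h
    rw [Bool.and_eq_true] at h'
    intro k hk
    rcases Nat.lt_succ_iff_lt_or_eq.mp hk with hk | rfl
    · exact ih h'.2 k hk
    · exact h'.1

theorem hasBit_eq (x i : ℕ) : hasBit x i = x.testBit i := by
  rw [Nat.testBit_eq_decide_div_mod_eq, ← Nat.shiftRight_eq_div_pow, Bool.eq_iff_iff]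
  simp only [hasBit, Nat.beq_eq, decide_eq_true_eq]
  rfl

set_option maxRecDepth 100000 in
theorem testBit_lowMask {i x : ℕ} (hi : i < 12) (hx : x < 4096) :
    (lowMask i).testBit x = !x.testBit i := by
  have h : allLt 12 (fun i => allLt 4096 fun x =>
      withLit x fun x => xor (hasBit (lowMask i) x) (hasBit x i)) = true := by
    decide +kernel
  have := allLt_imp (allLt_imp h i hi) x hx
  rw [withLit_eq, hasBit_eq, hasBit_eq] at this
  revert this
  cases (lowMask i).testBit x <;> cases x.testBit i <;> simp

theorem xor_two_pow_of_testBit_eq_false {x i : ℕ} (h : x.testBit i = false) :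
    x ^^^ 2 ^ i = 2 ^ i + x := by
  have hm : (x ^^^ 2 ^ i) % 2 ^ i = x % 2 ^ i := by
    rw [Nat.xor_mod_two_pow]; simp
  have hd : (x ^^^ 2 ^ i) / 2 ^ i = x / 2 ^ i + 1 := by
    rw [Nat.xor_div_two_pow, Nat.div_self (by positivity)]
    apply Nat.xor_one_of_even
    rw [Nat.testBit_eq_decide_div_mod_eq] at h
    simpa [Nat.even_iff] using h
  rw [← Nat.div_add_mod (x ^^^ 2 ^ i) (2 ^ i), hm, hd, mul_add, add_right_comm, Nat.div_add_mod]
  ring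

theorem testBit_flipRow {i x : ℕ} (hi : i < 12) (hx : x < 4096) (A : ℕ) :
    (flipRow i A).testBit x = A.testBit (x ^^^ 2 ^ i) := by
  have hx' : x ^^^ 2 ^ i < 2 ^ 12 := Nat.xor_lt_two_pow hx (Nat.pow_lt_pow_right (by simp) hi)
  have hflip : (flipRow i A) =
      ((A &&& lowMask i) <<< 2 ^ i) ||| ((A >>> 2 ^ i) &&& lowMask i) := withLit_eq _ _
  rw [hflip]
  simp only [Nat.testBit_or, Nat.testBit_shiftLeft, Nat.testBit_and, Nat.testBit_shiftRight,
    testBit_lowMask hi hx]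
  cases h : x.testBit i
  · rw [xor_two_pow_of_testBit_eq_false h]
    by_cases hle : 2 ^ i ≤ x
    · obtain ⟨y, rfl⟩ := Nat.exists_eq_add_of_le hle
      rw [Nat.testBit_two_pow_add_eq] at h
      rw [Nat.add_sub_cancel_left, testBit_lowMask hi (lt_of_le_of_lt (Nat.le_add_left _ _) hx)]
      simp_all
    · simp [hle]
  · have hle := Nat.ge_two_pow_of_testBit h
    obtain ⟨y, rfl⟩ := Nat.exists_eq_add_of_le hle
    rw [Nat.testBit_two_pow_add_eq] at h
    have hy : y.testBit i = false := by simpa using h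
    rw [← xor_two_pow_of_testBit_eq_false hy, Nat.xor_xor_cancel_right,
      xor_two_pow_of_testBit_eq_false hy, Nat.add_sub_cancel_left,
      testBit_lowMask hi (lt_of_le_of_lt (Nat.le_add_left _ _) hx)]
    simp [hy]

theorem testBit_shiftRow {v n x : ℕ} (hn : n ≤ 12) (hx : x < 4096) (A : ℕ) :
    (shiftRow v n A).testBit x = A.testBit (x ^^^ v % 2 ^ n) := by
  induction n generalizing x with
  | zero => simp [shiftRow, Nat.mod_one]
  | succ k ih =>
    have hs : shiftRow v (k + 1) A = cond (hasBit v k) (flipRow k (shiftRow v k A))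
        (shiftRow v k A) := rfl
    have hx' : x ^^^ 2 ^ k < 2 ^ 12 := Nat.xor_lt_two_pow hx (Nat.pow_lt_pow_right (by simp) hn)
    have hbit : v / 2 ^ k % 2 = (v.testBit k).toNat := (Nat.toNat_testBit v k).symm
    rw [hs, hasBit_eq]
    cases h : v.testBit k
    · have : v % 2 ^ (k + 1) = v % 2 ^ k := by
        rw [Nat.mod_pow_succ, hbit, h]; simp
      rw [cond_false, ih (by omega) hx, this]
    · have : v % 2 ^ (k + 1) = 2 ^ k ^^^ v % 2 ^ k := by
        rw [Nat.mod_pow_succ, hbit, h, Nat.xor_comm, xor_two_pow_of_testBit_eq_false (by simp)]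
        simp [add_comm]
      rw [cond_true, testBit_flipRow hn hx, ih (by omega) hx', this, Nat.xor_assoc]

theorem swapBits_eq (i j x : ℕ) :
    swapBits i j x = if x.testBit i = x.testBit j then x else x ^^^ 2 ^ i ^^^ 2 ^ j := by
  have h : swapBits i j x = cond (xor (hasBit x i) (hasBit x j)) (x ^^^ 2 ^ i ^^^ 2 ^ j) x :=
    withLit_eq _ _
  rw [h, hasBit_eq, hasBit_eq]
  cases x.testBit i <;> cases x.testBit j <;> rfl

theorem testBit_swapBits (i j x k : ℕ) :
    (swapBits i j x).testBit k = x.testBit (Equiv.swap i j k) := by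
  rw [swapBits_eq, Equiv.swap_apply_def]
  split_ifs <;> simp_all [Nat.testBit_xor, Nat.testBit_two_pow] <;> grind

theorem swapBits_lt {i j x n : ℕ} (hi : i < n) (hj : j < n) (hx : x < 2 ^ n) :
    swapBits i j x < 2 ^ n := by
  rw [swapBits_eq]
  split_ifs
  · exact hx
  · exact Nat.xor_lt_two_pow (Nat.xor_lt_two_pow hx (Nat.pow_lt_pow_right (by simp) hi))
      (Nat.pow_lt_pow_right (by simp) hj)

theorem testBit_swapRow {i j x : ℕ} (hi : i < 12) (hj : j < 12) (hx : x < 4096) (A : ℕ) :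
    (swapRow i j A).testBit x = A.testBit (swapBits i j x) := by
  have hx' : x ^^^ 2 ^ i < 2 ^ 12 := Nat.xor_lt_two_pow hx (Nat.pow_lt_pow_right (by simp) hi)
  have hs : swapRow i j A =
      A ^^^ ((A ^^^ flipRow i (flipRow j A)) &&& (lowMask i ^^^ lowMask j)) := withLit_eq _ _
  rw [hs, swapBits_eq]
  simp only [Nat.testBit_xor, Nat.testBit_and, testBit_lowMask hi hx, testBit_lowMask hj hx,
    testBit_flipRow hi hx, testBit_flipRow hj hx']
  cases h₁ : x.testBit i <;> cases h₂ : x.testBit j <;> simp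

theorem exists_perm_testBit_permBits (l : List (ℕ × ℕ)) :
    ∃ e : Equiv.Perm ℕ, ∀ x k, (permBits l x).testBit k = x.testBit (e k) := by
  induction l with
  | nil => exact ⟨1, fun x k => rfl⟩
  | cons p l ih =>
    obtain ⟨e, he⟩ := ih
    refine ⟨e * Equiv.swap p.1 p.2, fun x k => ?_⟩
    have hp : permBits (p :: l) x = swapBits p.1 p.2 (permBits l x) := rfl
    rw [hp, testBit_swapBits, he, Equiv.Perm.mul_apply]

theorem permBits_xor (l : List (ℕ × ℕ)) (x y : ℕ) :
    permBits l (x ^^^ y) = permBits l x ^^^ permBits l y := by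
  obtain ⟨e, he⟩ := exists_perm_testBit_permBits l
  exact Nat.eq_of_testBit_eq fun k => by simp [he]

theorem permBits_and (l : List (ℕ × ℕ)) (x y : ℕ) :
    permBits l (x &&& y) = permBits l x &&& permBits l y := by
  obtain ⟨e, he⟩ := exists_perm_testBit_permBits l
  exact Nat.eq_of_testBit_eq fun k => by simp [he]

theorem permBits_eq_zero {l : List (ℕ × ℕ)} {x : ℕ} : permBits l x = 0 ↔ x = 0 := by
  obtain ⟨e, he⟩ := exists_perm_testBit_permBits l
  constructor <;> intro h <;> refine Nat.eq_of_testBit_eq fun k => ?_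
  · simpa [h] using (he x (e.symm k)).symm
  · simp [he, h]

theorem permBits_lt {l : List (ℕ × ℕ)} {n x : ℕ} (hl : ∀ p ∈ l, p.1 < n ∧ p.2 < n)
    (hx : x < 2 ^ n) : permBits l x < 2 ^ n := by
  induction l with
  | nil => exact hx
  | cons p l ih =>
    obtain ⟨hp, hl⟩ := List.forall_mem_cons.mp hl
    exact swapBits_lt hp.1 hp.2 (ih hl)

theorem testBit_permRow {l : List (ℕ × ℕ)} (hl : ∀ p ∈ l, p.1 < 11 ∧ p.2 < 11) {x : ℕ}
    (hx : x < 4096) (A : ℕ) : (permRow l A).testBit x = A.testBit (permBits l x) := by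
  induction l generalizing A with
  | nil => rfl
  | cons p l ih =>
    obtain ⟨hp, hl⟩ := List.forall_mem_cons.mp hl
    have hr : permRow (p :: l) A = permRow l (swapRow p.1 p.2 A) := rfl
    have hb : permBits (p :: l) x = swapBits p.1 p.2 (permBits l x) := rfl
    have hlt : permBits l x < 2 ^ 12 := permBits_lt (fun q hq => by have := hl q hq; omega) hx
    rw [hr, hb, ih hl, testBit_swapRow (by omega) (by omega) hlt]

theorem allDisjoint_imp {u n v w : ℕ} {p : ℕ → Bool} (h : allDisjoint u p n v = true)
    (hw : w < 2 ^ n) (huw : u &&& w = 0) : p (v + w) = true := by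
  induction n generalizing v w with
  | zero =>
    obtain rfl : w = 0 := by simpa using hw
    exact h
  | succ n ih =>
    have h' : (allDisjoint u p n v && (hasBit u n || allDisjoint u p n (v + 2 ^ n))) = true := h
    rw [Bool.and_eq_true, Bool.or_eq_true, hasBit_eq] at h'
    by_cases hlt : w < 2 ^ n
    · exact ih h'.1 hlt huw
    · obtain ⟨y, rfl⟩ := Nat.exists_eq_add_of_le (not_lt.mp hlt)
      have hy : y < 2 ^ n := by rw [pow_succ] at hw; omega
      have hyn : y.testBit n = false := Nat.testBit_lt_two_pow hy
      rw [← xor_two_pow_of_testBit_eq_false hyn] at huw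
      have hbit : ∀ k, (u.testBit k && (y.testBit k ^^ (2 ^ n).testBit k)) = false := fun k => by
        simpa using congrArg (Nat.testBit · k) huw
      have hun : u.testBit n = false := by simpa [hyn] using hbit n
      rw [← add_assoc]
      refine ih (h'.2.resolve_left (by simp [hun])) hy (Nat.eq_of_testBit_eq fun k => ?_)
      have := hbit k
      by_cases hk : n = k
      · simp [← hk, hun]
      · simpa [Nat.testBit_two_pow_of_ne hk] using this

theorem mem_of_testBit_bitSet {l : List ℕ} {u : ℕ} (h : (bitSet l).testBit u = true) : u ∈ l := by
  induction l with
  | nil => simp [bitSet] at h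
  | cons v l ih =>
    have hb : bitSet (v :: l) = bitSet l ||| 2 ^ v := rfl
    rw [hb, Nat.testBit_or, Bool.or_eq_true, Nat.testBit_two_pow, decide_eq_true_eq] at h
    rcases h with h | rfl
    · exact List.mem_cons_of_mem _ (ih h)
    · exact List.mem_cons_self

theorem of_testBit_orbitOf {l : List (ℕ × ℕ)} (hl : ∀ p ∈ l, p.1 < 11 ∧ p.2 < 11) {Q : ℕ → Prop}
    (hQ : ∀ u < 2048, Q (permBits l u) → Q u) {S : ℕ} (hS : ∀ u < 2048, S.testBit u = true → Q u)
    (n : ℕ) : ∀ u < 2048, (orbitOf l n S).testBit u = true → Q u := by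
  induction n with
  | zero => exact hS
  | succ n ih =>
    intro u hu h
    have ho : orbitOf l (n + 1) S = orbitOf l n S ||| permRow l (orbitOf l n S) :=
      withLit_eq (orbitOf l n S) fun S => S ||| permRow l S
    rw [ho, Nat.testBit_or, Bool.or_eq_true, testBit_permRow hl (by omega)] at h
    rcases h with h | h
    · exact ih u hu h
    · exact hQ u hu (ih _ (permBits_lt (n := 11) hl hu) h)

set_option maxRecDepth 100000 in
theorem checks :
    Nat.beq (Nat.lor (orbitOf tripling 4 (orbitOf rotation 10 (bitSet orbitReps))) 1)
        (Nat.sub (Nat.pow 2 2048) 1) = true ∧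
      allLt 2048 rowOk = true ∧ ∀ u ∈ orbitReps, directionOk u = true := by
  have h : and (Nat.beq (Nat.lor (orbitOf tripling 4 (orbitOf rotation 10 (bitSet orbitReps))) 1)
        (Nat.sub (Nat.pow 2 2048) 1))
      (and (allLt 2048 rowOk) (orbitReps.all directionOk)) = true := by
    decide +kernel
  simpa only [Bool.and_eq_true, List.all_eq_true] using h

theorem rotation_lt : ∀ p ∈ rotation, p.1 < 11 ∧ p.2 < 11 := by decide

theorem tripling_lt : ∀ p ∈ tripling, p.1 < 11 ∧ p.2 < 11 := by decide

theorem testBit_fullRow (n x : ℕ) : (Nat.sub (Nat.pow 2 n) 1).testBit x = decide (x < n) :=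
  Nat.testBit_two_pow_sub_one n x

theorem rowOk_of_lt {u : ℕ} (hu : u < 2048) :
    shiftRow u 11 (row u) = row u ∧
      Nat.xor (flipRow 11 (row u)) (row u) = Nat.sub (Nat.pow 2 4096) 1 ∧
      permRow rotation (row (permBits rotation u)) = row u ∧
      permRow tripling (row (permBits tripling u)) = row u := by
  have h := allLt_imp checks.2.1 u hu
  rw [rowOk, withLit_eq] at h
  simp only [Bool.and_eq_true, Nat.beq_eq] at h
  exact h

theorem testBit_row_xor_self {u x : ℕ} (hu : u < 2048) (hx : x < 4096) :
    (row u).testBit (x ^^^ u) = (row u).testBit x := by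
  have h := congrArg (Nat.testBit · x) (rowOk_of_lt hu).1
  have hm : u % 2 ^ 11 = u := Nat.mod_eq_of_lt hu
  simpa only [testBit_shiftRow (v := u) (n := 11) (by norm_num) hx, hm] using h

theorem testBit_row_xor_top {u x : ℕ} (hu : u < 2048) (hx : x < 4096) :
    (row u).testBit (x ^^^ 2 ^ 11) = !(row u).testBit x := by
  have h := congrArg (Nat.testBit · x) (rowOk_of_lt hu).2.1
  have hxor : ∀ A B : ℕ, Nat.xor A B = A ^^^ B := fun _ _ => rfl
  simp only [hxor, Nat.testBit_xor, testBit_flipRow (i := 11) (by norm_num) hx,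
    testBit_fullRow, hx, decide_true] at h
  revert h
  cases (row u).testBit (x ^^^ 2 ^ 11) <;> cases (row u).testBit x <;> simp

/-- No rectangle with `u` as one of its directions has all its edges of colour `true`. -/
def DirectionGood (u : ℕ) : Prop :=
  ∀ v x, v < 2048 → x < 4096 → v ≠ 0 → u &&& v = 0 →
    ¬((row u).testBit x = true ∧ (row u).testBit (x ^^^ v) = true ∧
      (row v).testBit x = true ∧ (row v).testBit (x ^^^ u) = true ∧
      (row (u ^^^ v)).testBit x = true ∧ (row (u ^^^ v)).testBit (x ^^^ u) = true)

theorem directionGood_of_mem {u : ℕ} (hu : u < 2048) (h : u ∈ orbitReps) : DirectionGood u := by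
  intro v x hv hx hv0 huv ⟨h₁, h₂, h₃, h₄, h₅, h₆⟩
  have hd := checks.2.2 u h
  rw [directionOk, withLit_eq] at hd
  have hv' := allDisjoint_imp hd hv huv
  rw [Nat.zero_add, withLit_eq, Bool.or_eq_true, noMono, withLit_eq, Nat.beq_eq, Nat.beq_eq] at hv'
  have hP := congrArg (Nat.testBit · x) (hv'.resolve_left hv0)
  have hx' : x ^^^ u < 2 ^ 12 := Nat.xor_lt_two_pow hx (by omega)
  have hxv : x ^^^ v < 2 ^ 12 := Nat.xor_lt_two_pow hx (by omega)
  have hmu : u % 2 ^ 11 = u := Nat.mod_eq_of_lt hu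
  have hmv : v % 2 ^ 11 = v := Nat.mod_eq_of_lt hv
  have hland : ∀ A B : ℕ, Nat.land A B = A &&& B := fun _ _ => rfl
  have hxor : Nat.xor u v = u ^^^ v := rfl
  simp only [hland, hxor, Nat.testBit_and, testBit_shiftRow (n := 11) (by norm_num) hx,
    testBit_shiftRow (n := 11) (by norm_num) hx', hmu, hmv] at hP
  rw [testBit_row_xor_self hu hx, Nat.xor_right_comm, testBit_row_xor_self hu hxv] at hP
  simp [h₁, h₂, h₃, h₄, h₅, h₆] at hP

theorem DirectionGood.of_permBits {l : List (ℕ × ℕ)} (hl : ∀ p ∈ l, p.1 < 11 ∧ p.2 < 11)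
    (hrow : ∀ u < 2048, permRow l (row (permBits l u)) = row u) {u : ℕ} (hu : u < 2048)
    (h : DirectionGood (permBits l u)) : DirectionGood u := by
  have hrow' : ∀ w < 2048, ∀ x < 4096,
      (row (permBits l w)).testBit (permBits l x) = (row w).testBit x := fun w hw x hx => by
    rw [← testBit_permRow hl hx, hrow w hw]
  intro v x hv hx hv0 huv hmono
  have hl' : ∀ p ∈ l, p.1 < 12 ∧ p.2 < 12 := fun p hp => by have := hl p hp; omega
  refine h (permBits l v) (permBits l x) (permBits_lt (n := 11) hl hv)
    (permBits_lt (n := 12) hl' hx) (permBits_eq_zero.not.mpr hv0)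
    (by rw [← permBits_and, huv, permBits_eq_zero]) ?_
  have hw : u ^^^ v < 2 ^ 11 := Nat.xor_lt_two_pow hu hv
  have hxu : x ^^^ u < 2 ^ 12 := Nat.xor_lt_two_pow hx (by omega)
  have hxv : x ^^^ v < 2 ^ 12 := Nat.xor_lt_two_pow hx (by omega)
  simp only [← permBits_xor]
  rwa [hrow' u hu x hx, hrow' u hu _ hxv, hrow' v hv x hx, hrow' v hv _ hxu, hrow' _ hw x hx,
    hrow' _ hw _ hxu]

theorem directionGood {u : ℕ} (hu : u < 2048) (hu0 : u ≠ 0) : DirectionGood u := by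
  have hrot := of_testBit_orbitOf rotation_lt (Q := DirectionGood)
    (fun _ hw => .of_permBits rotation_lt (fun w hw => (rowOk_of_lt hw).2.2.1) hw)
    (fun _ hw h => directionGood_of_mem hw (mem_of_testBit_bitSet h)) 10
  refine of_testBit_orbitOf tripling_lt
    (fun _ hw => .of_permBits tripling_lt (fun w hw => (rowOk_of_lt hw).2.2.2) hw) hrot 4 u hu ?_
  have h := congrArg (Nat.testBit · u) (Nat.eq_of_beq_eq_true checks.1)
  have hlor : ∀ A B : ℕ, Nat.lor A B = A ||| B := fun _ _ => rfl
  simp only [hlor, Nat.testBit_or, testBit_fullRow, hu, decide_true, Bool.or_eq_true] at h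
  exact h.resolve_right (by simp [Nat.testBit_one_eq_true_iff_self_eq_zero, hu0])

/-- The vertices of the cube, numbered in binary. -/
def vertexCode (a : Fin 11 → Bool) : ℕ := Nat.ofBits a

theorem vertexCode_lt (a : Fin 11 → Bool) : vertexCode a < 2 ^ 11 := Nat.ofBits_lt_two_pow a

theorem vertexCode_xor_lt (a b : Fin 11 → Bool) : vertexCode a ^^^ vertexCode b < 2048 :=
  Nat.xor_lt_two_pow (vertexCode_lt a) (vertexCode_lt b)

theorem testBit_vertexCode (a : Fin 11 → Bool) (k : Fin 11) :
    (vertexCode a).testBit k = a k := Nat.testBit_ofBits_lt a k k.2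

theorem vertexCode_injective : Function.Injective vertexCode := fun a b h =>
  funext fun k => by rw [← testBit_vertexCode a, h, testBit_vertexCode]

theorem eq_of_testBit_fin {x y : ℕ} (hx : x < 2 ^ 11) (hy : y < 2 ^ 11)
    (h : ∀ k : Fin 11, x.testBit k = y.testBit k) : x = y := by
  refine Nat.eq_of_testBit_eq fun k => ?_
  by_cases hk : k < 11
  · exact h ⟨k, hk⟩
  · have hle : 2 ^ 11 ≤ 2 ^ k := Nat.pow_le_pow_right (by norm_num) (by omega)
    rw [Nat.testBit_lt_two_pow (hx.trans_le hle), Nat.testBit_lt_two_pow (hy.trans_le hle)]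

/-- The edge colouring encoded by the rows. -/
def colouring : Sym2 (Fin 11 → Bool) → Bool :=
  Sym2.lift ⟨fun a b => (row (vertexCode a ^^^ vertexCode b)).testBit (vertexCode a),
    fun a b => by
      have h := testBit_row_xor_self (vertexCode_xor_lt a b) (x := vertexCode a)
        ((vertexCode_lt a).trans (by norm_num))
      rw [Nat.xor_xor_cancel_left] at h
      change (row _).testBit _ = (row _).testBit _
      rw [← h, Nat.xor_comm]⟩

theorem colouring_mk (a b : Fin 11 → Bool) :
    colouring s(a, b) = (row (vertexCode a ^^^ vertexCode b)).testBit (vertexCode a) := rfl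

theorem not_mono_of_rectangle {a b d e : Fin 11 → Bool} (hab : a ≠ b) (had : a ≠ d)
    (h : ∀ k, (a k = b k ∧ d k = e k) ∨ (a k = d k ∧ b k = e k)) :
    ¬ (colouring s(a, b) = colouring s(a, d) ∧ colouring s(a, b) = colouring s(a, e) ∧
       colouring s(a, b) = colouring s(b, d) ∧ colouring s(a, b) = colouring s(b, e) ∧
       colouring s(a, b) = colouring s(d, e)) := by
  have hu := vertexCode_xor_lt a b
  have hv := vertexCode_xor_lt a d
  have hu0 : vertexCode a ^^^ vertexCode b ≠ 0 := fun h0 =>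
    hab (vertexCode_injective (Nat.xor_eq_zero_iff.mp h0))
  have hv0 : vertexCode a ^^^ vertexCode d ≠ 0 := fun h0 =>
    had (vertexCode_injective (Nat.xor_eq_zero_iff.mp h0))
  have huv : (vertexCode a ^^^ vertexCode b) &&& (vertexCode a ^^^ vertexCode d) = 0 := by
    refine eq_of_testBit_fin (Nat.and_lt_two_pow _ hv) (by norm_num) fun k => ?_
    simp only [Nat.testBit_and, Nat.testBit_xor, testBit_vertexCode, Nat.zero_testBit]
    rcases h k with h | h <;> simp [h.1]
  have he : vertexCode e =
      vertexCode a ^^^ (vertexCode a ^^^ vertexCode b) ^^^ (vertexCode a ^^^ vertexCode d) := by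
    refine eq_of_testBit_fin (vertexCode_lt e)
      (Nat.xor_lt_two_pow (Nat.xor_lt_two_pow (vertexCode_lt a) hu) hv) fun k => ?_
    simp only [Nat.testBit_xor, testBit_vertexCode]
    rcases h k with h | h <;> simp [h.1, h.2]
  have hb : vertexCode b = vertexCode a ^^^ (vertexCode a ^^^ vertexCode b) := by
    rw [Nat.xor_xor_cancel_left]
  have hd : vertexCode d = vertexCode a ^^^ (vertexCode a ^^^ vertexCode d) := by
    rw [Nat.xor_xor_cancel_left]
  have hx := vertexCode_lt a
  simp only [colouring_mk]
  rw [he]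
  generalize vertexCode a ^^^ vertexCode b = u at *
  generalize vertexCode a ^^^ vertexCode d = v at *
  rw [hb, hd]
  generalize vertexCode a = x at *
  have hgood := directionGood hu hu0 v
  have hx₂ : x < 4096 := by omega
  have hxu : x ^^^ u < 2 ^ 11 := Nat.xor_lt_two_pow hx hu
  have hxv : x ^^^ v < 2 ^ 11 := Nat.xor_lt_two_pow hx hv
  have hw : u ^^^ v < 2 ^ 11 := Nat.xor_lt_two_pow hu hv
  have e₁ : x ^^^ (x ^^^ u ^^^ v) = u ^^^ v := by rw [Nat.xor_assoc, Nat.xor_xor_cancel_left]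
  have e₂ : x ^^^ u ^^^ (x ^^^ v) = u ^^^ v := by
    rw [Nat.xor_right_comm, Nat.xor_xor_cancel_left, Nat.xor_comm]
  have e₃ : x ^^^ u ^^^ (x ^^^ u ^^^ v) = v := Nat.xor_xor_cancel_left _ _
  have e₄ : x ^^^ v ^^^ (x ^^^ u ^^^ v) = u := by
    rw [Nat.xor_right_comm x u v, Nat.xor_xor_cancel_left]
  rw [e₁, e₂, e₃, e₄]
  rintro ⟨h₁, h₂, h₃, h₄, h₅⟩
  cases hc : (row u).testBit x
  · rw [hc] at h₁ h₂ h₃ h₄ h₅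
    refine hgood (x ^^^ 2 ^ 11) hv (Nat.xor_lt_two_pow (n := 12) hx₂ (by norm_num)) hv0 huv ?_
    rw [Nat.xor_right_comm x _ v, Nat.xor_right_comm x _ u, testBit_row_xor_top hu hx₂,
      testBit_row_xor_top hu (by omega), testBit_row_xor_top hv hx₂,
      testBit_row_xor_top hv (by omega), testBit_row_xor_top hw hx₂,
      testBit_row_xor_top hw (by omega), hc, ← h₁, ← h₂, ← h₃, ← h₄, ← h₅]
    simp
  · rw [hc] at h₁ h₂ h₃ h₄ h₅
    exact hgood x hv hx₂ hv0 huv ⟨hc, h₅.symm, h₁.symm, h₄.symm, h₂.symm, h₃.symm⟩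

theorem exists_weights_of_coplanar {n : ℕ} {a b d e : Fin n → Bool}
    (h : Coplanar ℝ ({toPoint n a, toPoint n b, toPoint n d, toPoint n e} : Set (Fin n → ℝ))) :
    ∃ w : Fin 4 → ℝ, w 0 + w 1 + w 2 + w 3 = 0 ∧
      (∀ k, w 0 * toPoint n a k + w 1 * toPoint n b k + w 2 * toPoint n d k +
        w 3 * toPoint n e k = 0) ∧ ∃ i, w i ≠ 0 := by
  let p : Fin 4 → Fin n → ℝ := ![toPoint n a, toPoint n b, toPoint n d, toPoint n e]
  have hr : Set.range p =
      ({toPoint n a, toPoint n b, toPoint n d, toPoint n e} : Set (Fin n → ℝ)) := by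
    ext x
    simp [p]
    tauto
  have hdep : ¬ AffineIndependent ℝ p := by
    rw [← finrank_vectorSpan_le_iff_not_affineIndependent ℝ p (n := 2) (by simp), hr]
    exact h.finrank_le_two
  rw [affineIndependent_iff_of_fintype] at hdep
  push Not at hdep
  obtain ⟨w, hw, hwp, hne⟩ := hdep
  rw [Finset.weightedVSub_eq_linear_combination _ hw] at hwp
  refine ⟨w, by simpa only [Fin.sum_univ_four] using hw, fun k => ?_, hne⟩
  simpa [Fin.sum_univ_four, p] using congrFun hwp k

theorem weight_eq_zero_of_ne {n : ℕ} {a b d e : Fin n → Bool} {w₁ w₂ w₃ w₄ : ℝ} (hab : a ≠ b)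
    (hw : w₁ + w₂ + w₃ + w₄ = 0)
    (hp : ∀ k, w₁ * toPoint n a k + w₂ * toPoint n b k + w₃ * toPoint n d k +
        w₄ * toPoint n e k = 0) :
    w₁ = 0 ∨ w₂ = 0 ∨ w₁ + w₃ = 0 ∨ w₁ + w₄ = 0 := by
  obtain ⟨k, hk⟩ := Function.ne_iff.mp hab
  have := hp k
  unfold toPoint at this
  cases ha : a k <;> cases hb : b k <;> cases hd : d k <;> cases he : e k <;>
    simp [ha, hb, hd, he] at this hk <;> grind

theorem weights_eq_zero {n : ℕ} {a b d e : Fin n → Bool} {w₁ w₂ w₃ w₄ : ℝ}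
    (hbd : b ≠ d) (hbe : b ≠ e) (hde : d ≠ e) (hw : w₁ + w₂ + w₃ + w₄ = 0)
    (hp : ∀ k, w₁ * toPoint n a k + w₂ * toPoint n b k + w₃ * toPoint n d k +
        w₄ * toPoint n e k = 0) (h : w₁ = 0) :
    w₂ = 0 ∧ w₃ = 0 ∧ w₄ = 0 := by
  have h₁ := weight_eq_zero_of_ne (d := a) (e := e) (w₁ := w₂) (w₂ := w₃) (w₃ := w₁) (w₄ := w₄) hbd
    (by linarith) fun k => by linarith [hp k]
  have h₂ := weight_eq_zero_of_ne (d := a) (e := d) (w₁ := w₂) (w₂ := w₄) (w₃ := w₁) (w₄ := w₃) hbe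
    (by linarith) fun k => by linarith [hp k]
  have h₃ := weight_eq_zero_of_ne (d := a) (e := b) (w₁ := w₃) (w₂ := w₄) (w₃ := w₁) (w₄ := w₂) hde
    (by linarith) fun k => by linarith [hp k]
  grind

theorem rectangle_of_weights {n : ℕ} {a b d e : Fin n → Bool} {w₁ w₂ w₃ w₄ : ℝ}
    (hw : w₁ + w₂ + w₃ + w₄ = 0)
    (hp : ∀ k, w₁ * toPoint n a k + w₂ * toPoint n b k + w₃ * toPoint n d k +
        w₄ * toPoint n e k = 0)
    (h₁ : w₁ ≠ 0) (h₂ : w₂ ≠ 0) (h₃ : w₃ ≠ 0) (h₄ : w₄ ≠ 0) :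
    (∀ k, (a k = b k ∧ d k = e k) ∨ (a k = d k ∧ b k = e k)) ∨
    (∀ k, (a k = b k ∧ d k = e k) ∨ (a k = e k ∧ b k = d k)) ∨
    (∀ k, (a k = d k ∧ b k = e k) ∨ (a k = e k ∧ b k = d k)) := by
  have hk : ∀ k, (a k = b k ∧ d k = e k ∧ (a k = d k ∨ w₁ + w₂ = 0)) ∨
      (a k = d k ∧ b k = e k ∧ w₁ + w₃ = 0) ∨ (a k = e k ∧ b k = d k ∧ w₁ + w₄ = 0) := by
    intro k
    have := hp k
    unfold toPoint at this
    cases ha : a k <;> cases hb : b k <;> cases hd : d k <;> cases he : e k <;>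
      simp [ha, hb, hd, he] at this ⊢ <;> grind
  by_contra! h
  obtain ⟨⟨i, hi⟩, ⟨j, hj⟩, ⟨k, hk'⟩⟩ := h
  have h₁₄ : w₁ + w₄ = 0 := by grind
  have h₁₃ : w₁ + w₃ = 0 := by grind
  have h₁₂ : w₁ + w₂ = 0 := by grind
  exact h₁ (by linarith)

/-- Distinct coplanar vertices of a cube are the vertices of a rectangle. -/
theorem rectangle_of_coplanar {n : ℕ} {a b d e : Fin n → Bool}
    (hab : a ≠ b) (had : a ≠ d) (hae : a ≠ e) (hbd : b ≠ d) (hbe : b ≠ e) (hde : d ≠ e)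
    (h : Coplanar ℝ ({toPoint n a, toPoint n b, toPoint n d, toPoint n e} : Set (Fin n → ℝ))) :
    (∀ k, (a k = b k ∧ d k = e k) ∨ (a k = d k ∧ b k = e k)) ∨
    (∀ k, (a k = b k ∧ d k = e k) ∨ (a k = e k ∧ b k = d k)) ∨
    (∀ k, (a k = d k ∧ b k = e k) ∨ (a k = e k ∧ b k = d k)) := by
  obtain ⟨w, hw, hp, i, hi⟩ := exists_weights_of_coplanar h
  have h₀ := weights_eq_zero hbd hbe hde hw hp
  have h₁ := weights_eq_zero (a := b) (b := a) (d := d) (e := e) (w₁ := w 1) (w₂ := w 0)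
    (w₃ := w 2) (w₄ := w 3) had hae hde (by linarith) fun k => by linarith [hp k]
  have h₂ := weights_eq_zero (a := d) (b := a) (d := b) (e := e) (w₁ := w 2) (w₂ := w 0)
    (w₃ := w 1) (w₄ := w 3) hab hae hbe (by linarith) fun k => by linarith [hp k]
  have h₃ := weights_eq_zero (a := e) (b := a) (d := b) (e := d) (w₁ := w 3) (w₂ := w 0)
    (w₃ := w 1) (w₄ := w 2) hab had hbd (by linarith) fun k => by linarith [hp k]
  refine rectangle_of_weights hw hp ?_ ?_ ?_ ?_ <;> intro h <;> fin_cases i <;> simp_all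

end CubeColouring

theorem exists_good_colouring_C11 :
    ∃ c : Sym2 (Fin 11 → Bool) → Bool, NoMonoPlanarK4 11 c := by
  refine ⟨CubeColouring.colouring, fun a b d e hab had hae hbd hbe hde h => ?_⟩
  rintro ⟨h₁, h₂, h₃, h₄, h₅⟩
  rcases CubeColouring.rectangle_of_coplanar hab had hae hbd hbe hde h with h | h | h
  · exact CubeColouring.not_mono_of_rectangle hab had h ⟨h₁, h₂, h₃, h₄, h₅⟩
  · refine CubeColouring.not_mono_of_rectangle (a := a) (b := b) (d := e) (e := d) hab hae
      (fun k => (h k).imp (fun h => ⟨h.1, h.2.symm⟩) id) ⟨h₂, h₁, h₄, h₃, ?_⟩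
    rw [h₅, Sym2.eq_swap]
  · refine CubeColouring.not_mono_of_rectangle (a := a) (b := d) (d := e) (e := b) had hae
      (fun k => (h k).imp (fun h => ⟨h.1, h.2.symm⟩) fun h => ⟨h.1, h.2.symm⟩)
      ⟨h₁.symm.trans h₂, h₁.symm, h₁.symm.trans h₅, ?_, ?_⟩
    · rw [← h₁, h₃, Sym2.eq_swap]
    · rw [← h₁, h₄, Sym2.eq_swap]
end

section
/- There exists a 2-colouring of the edges of K(C_3) (the complete graph on the 8 vertices of the 3-dimensional cube) containing no monochromatic planar K_4. -/
/-- The residue modulo `3` of the number of ones of a vertex of the cube `C_3`. -/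
def weightMod3 (v : Fin 3 → Bool) : Fin 3 := ∑ i, if v i then 1 else 0

theorem card_fiber_weightMod3_le (k : Fin 3) :
    (Finset.univ.filter fun v => weightMod3 v = k).card ≤ 3 := by
  revert k
  decide

/-- Colour an edge according to whether its ends lie in the same fibre of `f`. If `f` takes at most
three values, each at most three times, then no `K₄` is monochromatic, planar or not. -/
theorem noMonoPlanarK4_of_card_fiber_le {n : ℕ} (f : (Fin n → Bool) → Fin 3)
    (hf : ∀ k, (Finset.univ.filter fun v => f v = k).card ≤ 3) :
    NoMonoPlanarK4 n fun e => decide (e.map f).IsDiag := by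
  intro a b d e hab had hae hbd hbe hde _ hmono
  simp only [Sym2.map_mk, Sym2.mk_isDiag_iff, decide_eq_decide] at hmono
  obtain ⟨h₁, h₂, h₃, h₄, h₅⟩ := hmono
  by_cases h : f a = f b
  · have hsub : ({a, b, d, e} : Finset (Fin n → Bool)) ⊆
        Finset.univ.filter fun v => f v = f a := by
      intro v hv
      simp only [Finset.mem_insert, Finset.mem_singleton] at hv
      rcases hv with rfl | rfl | rfl | rfl <;> simp_all
    have hcard : ({a, b, d, e} : Finset (Fin n → Bool)).card = 4 := by
      simp [*]
    have := (Finset.card_le_card hsub).trans (hf (f a))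
    omega
  · have hcard : ({f a, f b, f d, f e} : Finset (Fin 3)).card = 4 := by
      simp_all
    have := Finset.card_le_univ ({f a, f b, f d, f e} : Finset (Fin 3))
    simp only [Fintype.card_fin] at this
    omega

theorem exists_good_colouring_C3 :
    ∃ c : Sym2 (Fin 3 → Bool) → Bool, NoMonoPlanarK4 3 c :=
  ⟨_, noMonoPlanarK4_of_card_fiber_le weightMod3 card_fiber_weightMod3_le⟩
end

section
/- For every n ≥ 2, the number of planar K_4 subgraphs of K(C_n), i.e., the number of 4-element subsets of {0,1}^n whose four points are coplanar in ℝ^n, denoted n_K, satisfies 8 · n_K = 2^n · (3^n − 2^{n+1} + 1); equivalently, for n ≥ 3, n_K = 2^{n−3}(3^n − 2^{n+1} + 1). -/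
/-- The number of planar `K₄` subgraphs of `K(C_n)`: the number of 4-element subsets of
`{0,1}^n` whose points are coplanar in `ℝ^n`. -/
noncomputable def nK (n : ℕ) : ℕ :=
  Set.ncard {s : Finset (Fin n → Bool) |
    s.card = 4 ∧ Coplanar ℝ (toPoint n '' (s : Set (Fin n → Bool)))}

/-- The points `a, b, c, d` satisfy `a + d = b + c` coordinatewise, i.e. they are the vertices of
a (possibly degenerate) parallelogram with diagonals `ad` and `bc`. -/
def IsRect {n : ℕ} (a b c d : Fin n → Bool) : Prop :=
  ∀ i, (a i = b i ∧ c i = d i) ∨ (a i = c i ∧ b i = d i)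

instance {n : ℕ} (a b c d : Fin n → Bool) : Decidable (IsRect a b c d) :=
  inferInstanceAs (Decidable (∀ _, _))

/-- The ordered quadruples which form a nondegenerate parallelogram. -/
def rectQuads (n : ℕ) :
    Finset ((Fin n → Bool) × (Fin n → Bool) × (Fin n → Bool) × (Fin n → Bool)) :=
  {q | IsRect q.1 q.2.1 q.2.2.1 q.2.2.2 ∧ q.1 ≠ q.2.1 ∧ q.1 ≠ q.2.2.1}

/-- The underlying set of a quadruple. -/
def quadSet {α : Type*} [DecidableEq α] (q : α × α × α × α) : Finset α :=
  {q.1, q.2.1, q.2.2.1, q.2.2.2}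

namespace IsRect

variable {n : ℕ} {a b c d : Fin n → Bool}

theorem swap (h : IsRect a b c d) : IsRect a c b d := fun i => (h i).symm

theorem flip (h : IsRect a b c d) : IsRect b a d c := fun i => by
  have := h i
  grind

theorem ne_diag (h : IsRect a b c d) (hab : a ≠ b) : a ≠ d := by
  rintro rfl
  refine hab (funext fun i => ?_)
  have := h i
  grind

theorem ne_right (h : IsRect a b c d) (hac : a ≠ c) : b ≠ d := by
  rintro rfl
  refine hac (funext fun i => ?_)
  have := h i
  grind

/-- Two different pairings of the same points cannot both be parallelograms. -/
theorem eq_of_isRect (h : IsRect a b c d) (h' : IsRect a b d c) : a = b := by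
  funext i
  have := h i
  have := h' i
  grind

end IsRect

theorem mem_rectQuads {n : ℕ} {a b c d : Fin n → Bool} :
    (a, b, c, d) ∈ rectQuads n ↔ IsRect a b c d ∧ a ≠ b ∧ a ≠ c := by
  simp [rectQuads]

theorem rectQuads_distinct {n : ℕ} {a b c d : Fin n → Bool} (h : (a, b, c, d) ∈ rectQuads n) :
    a ≠ b ∧ a ≠ c ∧ a ≠ d ∧ b ≠ c ∧ b ≠ d ∧ c ≠ d := by
  obtain ⟨h, hab, hac⟩ := mem_rectQuads.1 h
  exact ⟨hab, hac, h.ne_diag hab, h.flip.ne_diag hab.symm, h.ne_right hac, h.swap.ne_right hab⟩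

theorem card_filter_quadSet {n : ℕ} {a b c d : Fin n → Bool} (h : (a, b, c, d) ∈ rectQuads n) :
    {q ∈ rectQuads n | quadSet q = quadSet (a, b, c, d)}.card = 8 := by
  obtain ⟨hab, hac, had, hbc, hbd, hcd⟩ := rectQuads_distinct h
  have hr := (mem_rectQuads.1 h).1
  have h₁ : ¬ IsRect a b d c := fun h' => hab (hr.eq_of_isRect h')
  have h₂ : ¬ IsRect a c d b := fun h' => hac (hr.swap.eq_of_isRect h')
  have key : {q ∈ rectQuads n | quadSet q = quadSet (a, b, c, d)} =
      {(a, b, c, d), (a, c, b, d), (d, b, c, a), (d, c, b, a),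
        (b, a, d, c), (b, d, a, c), (c, a, d, b), (c, d, a, b)} := by
    ext ⟨a', b', c', d'⟩
    simp only [Finset.mem_filter, Finset.mem_insert, Finset.mem_singleton, Prod.mk.injEq]
    constructor
    · rintro ⟨hq, hs⟩
      obtain ⟨hab', hac', had', hbc', hbd', hcd'⟩ := rectQuads_distinct hq
      have hq' := (mem_rectQuads.1 hq).1
      have hmem : ∀ x ∈ quadSet (a', b', c', d'), x = a ∨ x = b ∨ x = c ∨ x = d := by
        intro x hx
        rw [hs] at hx
        simpa [quadSet] using hx
      have ha := hmem a' (by simp [quadSet])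
      have hb := hmem b' (by simp [quadSet])
      have hc := hmem c' (by simp [quadSet])
      have hd := hmem d' (by simp [quadSet])
      have e₁ := hq'.swap
      have e₂ := hq'.flip
      have e₃ := hq'.flip.swap
      have e₄ := hq'.swap.flip
      have e₅ := hq'.swap.flip.swap
      have e₆ := hq'.flip.swap.flip
      have e₇ := hq'.flip.swap.flip.swap
      clear hmem hs hq h hr
      rcases ha with rfl | rfl | rfl | rfl <;> rcases hb with rfl | rfl | rfl | rfl <;>
        first
        | contradiction
        | (rcases hc with rfl | rfl | rfl | rfl <;>
            first
            | contradiction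
            | (rcases hd with rfl | rfl | rfl | rfl <;>
                first
                | contradiction
                | simp))
    · rintro (⟨rfl, rfl, rfl, rfl⟩ | ⟨rfl, rfl, rfl, rfl⟩ | ⟨rfl, rfl, rfl, rfl⟩ |
        ⟨rfl, rfl, rfl, rfl⟩ | ⟨rfl, rfl, rfl, rfl⟩ | ⟨rfl, rfl, rfl, rfl⟩ |
        ⟨rfl, rfl, rfl, rfl⟩ | ⟨rfl, rfl, rfl, rfl⟩) <;>
      refine ⟨mem_rectQuads.2 ⟨?_, by tauto, by tauto⟩, by ext; simp [quadSet] <;> tauto⟩ <;>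
      first
      | exact hr
      | exact hr.swap
      | exact hr.flip
      | exact hr.flip.swap
      | exact hr.swap.flip
      | exact hr.swap.flip.swap
      | exact hr.flip.swap.flip
      | exact hr.flip.swap.flip.swap
  rw [key]
  simp [Finset.card_insert_of_notMem, hab, hac, had, hbc, hbd, hcd, hab.symm, hac.symm, had.symm,
    hbc.symm, hbd.symm, hcd.symm]

/-- The quadruples of bits that can occur as a coordinate of a parallelogram. -/
def rectBits : Finset (Bool × Bool × Bool × Bool) :=
  {x | (x.1 = x.2.1 ∧ x.2.2.1 = x.2.2.2) ∨ (x.1 = x.2.2.1 ∧ x.2.1 = x.2.2.2)}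

theorem card_rectQuads (n : ℕ) : (rectQuads n).card + 2 * 4 ^ n = 6 ^ n + 2 ^ n := by
  let P : Finset (Fin n → Bool × Bool × Bool × Bool) := Fintype.piFinset fun _ => rectBits
  let A : Finset (Fin n → Bool × Bool × Bool × Bool) :=
    Fintype.piFinset fun _ => {x ∈ rectBits | x.1 = x.2.1}
  let B : Finset (Fin n → Bool × Bool × Bool × Bool) :=
    Fintype.piFinset fun _ => {x ∈ rectBits | x.1 = x.2.2.1}
  have hP : P.card = 6 ^ n := by
    rw [Fintype.card_piFinset_const]; rfl
  have hA : A.card = 4 ^ n := by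
    rw [Fintype.card_piFinset_const]; rfl
  have hB : B.card = 4 ^ n := by
    rw [Fintype.card_piFinset_const]; rfl
  have hAB : (A ∩ B).card = 2 ^ n := by
    have : A ∩ B = Fintype.piFinset fun _ => {x ∈ rectBits | x.1 = x.2.1 ∧ x.1 = x.2.2.1} := by
      ext f
      simp only [A, B, Finset.mem_inter, Fintype.mem_piFinset, Finset.mem_filter]
      grind
    rw [this, Fintype.card_piFinset_const]; rfl
  have hsub : A ∪ B ⊆ P := by
    intro f
    simp only [A, B, P, Finset.mem_union, Fintype.mem_piFinset, Finset.mem_filter]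
    grind
  have hcard : (rectQuads n).card = (P \ (A ∪ B)).card := by
    refine Finset.card_bij' (fun q _ i => (q.1 i, q.2.1 i, q.2.2.1 i, q.2.2.2 i))
      (fun f _ => (fun i => (f i).1, fun i => (f i).2.1, fun i => (f i).2.2.1,
        fun i => (f i).2.2.2)) ?_ ?_ ?_ ?_
    · rintro ⟨a, b, c, d⟩ h
      obtain ⟨hr, hab, hac⟩ := mem_rectQuads.1 h
      simp only [A, B, P, Finset.mem_sdiff, Finset.mem_union, Fintype.mem_piFinset,
        Finset.mem_filter, rectBits, Finset.mem_univ, true_and]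
      refine ⟨hr, ?_⟩
      rintro (h | h)
      · exact hab (funext fun i => (h i).2)
      · exact hac (funext fun i => (h i).2)
    · intro f h
      simp only [A, B, P, Finset.mem_sdiff, Finset.mem_union, Fintype.mem_piFinset,
        Finset.mem_filter, rectBits, Finset.mem_univ, true_and] at h
      exact mem_rectQuads.2 ⟨h.1, fun e => h.2 (.inl fun i => ⟨h.1 i, congrFun e i⟩),
        fun e => h.2 (.inr fun i => ⟨h.1 i, congrFun e i⟩)⟩
    · intros; rfl
    · intros; rfl
  have h₁ := Finset.card_sdiff_add_card_eq_card hsub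
  have h₂ := Finset.card_union_add_card_inter A B
  omega

/-- Three distinct vertices of the hypercube are affinely independent. -/
theorem weight_eq_zero_of_triple {n : ℕ} {p q r : Fin n → Bool} {x y z : ℝ}
    (hpq : p ≠ q) (hpr : p ≠ r) (hs : x + y + z = 0)
    (h : ∀ i, x * toPoint n p i + y * toPoint n q i + z * toPoint n r i = 0) : x = 0 := by
  obtain ⟨i, hi⟩ := Function.ne_iff.1 hpq
  obtain ⟨j, hj⟩ := Function.ne_iff.1 hpr
  have h₁ := h i
  have h₂ := h j
  simp only [toPoint] at h₁ h₂
  cases hp : p i <;> cases hq : q i <;> cases hr : r i <;>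
    cases hp' : p j <;> cases hq' : q j <;> cases hr' : r j <;>
    simp [hp, hq, hr, hp', hq', hr'] at hi hj h₁ h₂ <;> linarith

/-- If `a, b, c, d` satisfy an affine dependency with nonzero weights and do not form a
parallelogram with diagonals `ad` and `bc`, then the weights of `a` and `d` cancel. -/
theorem weight_add_eq_zero_of_not_isRect {n : ℕ} {a b c d : Fin n → Bool} {x y z w : ℝ}
    (hx : x ≠ 0) (hy : y ≠ 0) (hz : z ≠ 0) (hw : w ≠ 0) (hs : x + y + z + w = 0)
    (h : ∀ i, x * toPoint n a i + y * toPoint n b i + z * toPoint n c i + w * toPoint n d i = 0)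
    (hr : ¬ IsRect a b c d) : x + w = 0 := by
  obtain ⟨i, hi⟩ := not_forall.1 hr
  have h₁ := h i
  simp only [toPoint] at h₁
  cases ha : a i <;> cases hb : b i <;> cases hc : c i <;> cases hd : d i <;>
    simp [ha, hb, hc, hd] at hi h₁ <;>
    first
    | contradiction
    | linarith
    | exact absurd (by linarith) hx
    | exact absurd (by linarith) hy
    | exact absurd (by linarith) hz
    | exact absurd (by linarith) hw

theorem exists_isRect_of_dependent {n : ℕ} {a b c d : Fin n → Bool} {x y z w : ℝ}
    (hab : a ≠ b) (hac : a ≠ c) (had : a ≠ d) (hbc : b ≠ c) (hbd : b ≠ d) (hcd : c ≠ d)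
    (hs : x + y + z + w = 0)
    (h : ∀ i, x * toPoint n a i + y * toPoint n b i + z * toPoint n c i + w * toPoint n d i = 0)
    (hne : ¬ (x = 0 ∧ y = 0 ∧ z = 0 ∧ w = 0)) :
    IsRect a b c d ∨ IsRect a b d c ∨ IsRect a c d b := by
  have hx : x ≠ 0 := by
    rintro rfl
    have hy := weight_eq_zero_of_triple (x := y) (y := z) (z := w) hbc hbd (by linarith)
      fun i => by linarith [h i]
    have hz := weight_eq_zero_of_triple (x := z) (y := y) (z := w) hbc.symm hcd (by linarith)
      fun i => by linarith [h i]
    exact hne ⟨rfl, hy, hz, by linarith⟩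
  have hy : y ≠ 0 := by
    rintro rfl
    exact hx (weight_eq_zero_of_triple (x := x) (y := z) (z := w) hac had (by linarith)
      fun i => by linarith [h i])
  have hz : z ≠ 0 := by
    rintro rfl
    exact hx (weight_eq_zero_of_triple (x := x) (y := y) (z := w) hab had (by linarith)
      fun i => by linarith [h i])
  have hw : w ≠ 0 := by
    rintro rfl
    exact hx (weight_eq_zero_of_triple (x := x) (y := y) (z := z) hab hac (by linarith)
      fun i => by linarith [h i])
  by_contra! hc
  have h₁ := weight_add_eq_zero_of_not_isRect hx hy hz hw hs h hc.1
  have h₂ := weight_add_eq_zero_of_not_isRect hx hy hw hz (by linarith)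
    (fun i => by linarith [h i]) hc.2.1
  have h₃ := weight_add_eq_zero_of_not_isRect hx hz hw hy (by linarith)
    (fun i => by linarith [h i]) hc.2.2
  exact hx (by linarith)

theorem image_quadSet (n : ℕ) (a b c d : Fin n → Bool) :
    toPoint n '' (quadSet (a, b, c, d) : Set (Fin n → Bool)) =
      {toPoint n a, toPoint n b, toPoint n c, toPoint n d} := by
  simp [quadSet, Set.image_insert_eq]

theorem IsRect.coplanar {n : ℕ} {a b c d : Fin n → Bool} (h : IsRect a b c d) :
    Coplanar ℝ (toPoint n '' (quadSet (a, b, c, d) : Set (Fin n → Bool))) := by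
  rw [image_quadSet]
  have hd : toPoint n d = (toPoint n b -ᵥ toPoint n a) +ᵥ toPoint n c := by
    funext i
    have := h i
    simp only [toPoint, vsub_eq_sub, vadd_eq_add, Pi.add_apply, Pi.sub_apply]
    grind
  have hmem : toPoint n d ∈ affineSpan ℝ {toPoint n a, toPoint n b, toPoint n c} := by
    rw [hd]
    refine AffineSubspace.vadd_mem_of_mem_direction
      (AffineSubspace.vsub_mem_direction ?_ ?_) ?_ <;>
    exact mem_affineSpan ℝ (by simp)
  have := (coplanar_insert_iff_of_mem_affineSpan hmem).2
    (coplanar_triple ℝ (toPoint n a) (toPoint n b) (toPoint n c))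
  refine this.subset ?_
  intro x
  simp
  tauto

theorem exists_isRect_of_coplanar {n : ℕ} {a b c d : Fin n → Bool}
    (hab : a ≠ b) (hac : a ≠ c) (had : a ≠ d) (hbc : b ≠ c) (hbd : b ≠ d) (hcd : c ≠ d)
    (h : Coplanar ℝ (toPoint n '' (quadSet (a, b, c, d) : Set (Fin n → Bool)))) :
    IsRect a b c d ∨ IsRect a b d c ∨ IsRect a c d b := by
  rw [image_quadSet] at h
  let p : Fin 4 → Fin n → ℝ := ![toPoint n a, toPoint n b, toPoint n c, toPoint n d]
  have hp : Set.range p = {toPoint n a, toPoint n b, toPoint n c, toPoint n d} := by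
    ext x
    simp [p, Matrix.range_cons]
    tauto
  rw [← hp, coplanar_iff_finrank_le_two,
    finrank_vectorSpan_le_iff_not_affineIndependent ℝ p (by simp), affineIndependent_iff] at h
  push Not at h
  obtain ⟨s, w, hs, hsum, j, hj, hwj⟩ := h
  let v : Fin 4 → ℝ := fun i => if i ∈ s then w i else 0
  have hv : ∑ i, v i = 0 := by simpa [v] using hs
  have hvp : ∑ i, v i • p i = 0 := by simpa [v, ite_smul] using hsum
  have hvj : v j ≠ 0 := by simpa [v, hj] using hwj
  simp only [Fin.sum_univ_four] at hv hvp
  refine exists_isRect_of_dependent hab hac had hbc hbd hcd hv (fun i => ?_) ?_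
  · simpa [p] using congrFun hvp i
  · rintro ⟨h0, h1, h2, h3⟩
    fin_cases j
    exacts [hvj h0, hvj h1, hvj h2, hvj h3]

theorem setOf_coplanar_eq (n : ℕ) :
    {s : Finset (Fin n → Bool) | s.card = 4 ∧
      Coplanar ℝ (toPoint n '' (s : Set (Fin n → Bool)))} =
      ((rectQuads n).image quadSet : Finset (Finset (Fin n → Bool))) := by
  ext s
  simp only [Set.mem_ofPred_eq, Finset.coe_image, Set.mem_image, SetLike.mem_coe]
  constructor
  · rintro ⟨hs, hcop⟩
    obtain ⟨a, b, c, d, hab, hac, had, hbc, hbd, hcd, rfl⟩ := Finset.card_eq_four.1 hs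
    rcases exists_isRect_of_coplanar hab hac had hbc hbd hcd hcop with h | h | h
    · exact ⟨(a, b, c, d), mem_rectQuads.2 ⟨h, hab, hac⟩, rfl⟩
    · exact ⟨(a, b, d, c), mem_rectQuads.2 ⟨h, hab, had⟩, by ext; simp [quadSet]; tauto⟩
    · exact ⟨(a, c, d, b), mem_rectQuads.2 ⟨h, hac, had⟩, by ext; simp [quadSet]; tauto⟩
  · rintro ⟨⟨a, b, c, d⟩, hq, rfl⟩
    obtain ⟨hab, hac, had, hbc, hbd, hcd⟩ := rectQuads_distinct hq
    exact ⟨Finset.card_eq_four.2 ⟨a, b, c, d, hab, hac, had, hbc, hbd, hcd, rfl⟩,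
      (mem_rectQuads.1 hq).1.coplanar⟩

theorem card_rectQuads_eq (n : ℕ) : (rectQuads n).card = 8 * nK n := by
  rw [nK, setOf_coplanar_eq, Set.ncard_coe_finset,
    Finset.card_eq_sum_card_image quadSet (rectQuads n), mul_comm]
  refine Finset.sum_const_nat fun s hs => ?_
  obtain ⟨⟨a, b, c, d⟩, hq, rfl⟩ := Finset.mem_image.1 hs
  exact card_filter_quadSet hq

theorem count_planar_K4 (n : ℕ) (hn : 2 ≤ n) :
    (8 * nK n : ℤ) = 2 ^ n * (3 ^ n - 2 ^ (n + 1) + 1) ∧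
    (3 ≤ n → (nK n : ℤ) = 2 ^ (n - 3) * (3 ^ n - 2 ^ (n + 1) + 1)) := by
  have key : (8 * nK n : ℤ) = 2 ^ n * (3 ^ n - 2 ^ (n + 1) + 1) := by
    have h := card_rectQuads n
    rw [card_rectQuads_eq] at h
    zify at h
    have h6 : (6 : ℤ) ^ n = 2 ^ n * 3 ^ n := by rw [← mul_pow]; norm_num
    have h4 : (4 : ℤ) ^ n = 2 ^ n * 2 ^ n := by rw [← mul_pow]; norm_num
    rw [h6, h4] at h
    rw [pow_succ]
    linarith
  refine ⟨key, fun h3 => ?_⟩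
  obtain ⟨m, rfl⟩ := Nat.exists_eq_add_of_le h3
  rw [Nat.add_sub_cancel_left]
  rw [pow_add 2 3 m] at key
  linarith
end

section
/- There exists a 2-colouring of K(C_9) containing no monochromatic planar K_4 that is invariant under the full symmetric group S_9 acting on vertices by permuting the 9 coordinates, i.e., a colouring c with c({σ·u, σ·v}) = c({u, v}) for every permutation σ of the 9 coordinates and all distinct vertices u, v. -/
/-- The action of a coordinate permutation on a vertex of the hypercube:
`(σ • v) i = v (σ⁻¹ i)`. -/
def permAct (n : ℕ) (σ : Equiv.Perm (Fin n)) (v : Fin n → Bool) : Fin n → Bool :=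
  fun i => v (σ⁻¹ i)

/-- Colour of an edge `{u, v}` with `p = |u \ v|`, `q = |v \ u|` and `r = |u ∩ v|`, where vertices
are identified with subsets of the coordinates. The digit at `100 * min p q + 10 * max p q + r` of
the binary expansion of a constant found by a SAT solver is used. -/
def edgeTypeColour (p q r : ℕ) : Bool :=
  Nat.testBit
    2913033324715986991029711826156577472057224845155127005786283020112643019544578516737154227472127799890921644928595450424087948788465664
    (100 * min p q + 10 * max p q + r)

theorem edgeTypeColour_comm (p q r : ℕ) : edgeTypeColour p q r = edgeTypeColour q p r := by
  simp only [edgeTypeColour, min_comm, max_comm]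

/-- The colouring of the edges of the complete graph on the hypercube which depends only on
the sizes of the two differences and of the intersection of the endpoints. -/
def typeColouring (n : ℕ) : Sym2 (Fin n → Bool) → Bool :=
  Sym2.lift ⟨fun u v => edgeTypeColour
      (Finset.univ.filter fun i => u i = true ∧ v i = false).card
      (Finset.univ.filter fun i => v i = true ∧ u i = false).card
      (Finset.univ.filter fun i => u i = true ∧ v i = true).card, fun u v => by
    simp only
    rw [edgeTypeColour_comm]
    simp only [and_comm]⟩

theorem typeColouring_mk (n : ℕ) (u v : Fin n → Bool) :
    typeColouring n s(u, v) = edgeTypeColour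
      (Finset.univ.filter fun i => u i = true ∧ v i = false).card
      (Finset.univ.filter fun i => v i = true ∧ u i = false).card
      (Finset.univ.filter fun i => u i = true ∧ v i = true).card := rfl

theorem typeColouring_permAct (n : ℕ) (σ : Equiv.Perm (Fin n)) (u v : Fin n → Bool) :
    typeColouring n s(permAct n σ u, permAct n σ v) = typeColouring n s(u, v) := by
  simp only [typeColouring_mk]
  congr 1 <;> exact Finset.card_equiv σ⁻¹ fun i => by
    rw [Finset.mem_filter_univ, Finset.mem_filter_univ]
    rfl

set_option synthInstance.maxSize 10000 in
/-- The numbers `n₁, …, n₅` count the coordinates of the possible patterns in a parallelogram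
with diagonals `{a, b}` and `{d, e}`: those equal to `1` exactly on `{a, d}`, `{b, e}`, `{a, e}`,
`{b, d}` and on all four vertices, respectively. -/
theorem edgeTypeColour_parallelogram :
    ∀ n₁ < 10, ∀ n₂ < 10 - n₁, ∀ n₃ < 10 - n₁ - n₂, ∀ n₄ < 10 - n₁ - n₂ - n₃,
      ∀ n₅ < 10 - n₁ - n₂ - n₃ - n₄, n₁ + n₂ ≠ 0 → n₃ + n₄ ≠ 0 →
      ¬ (edgeTypeColour (n₁ + n₃) (n₂ + n₄) n₅ = edgeTypeColour n₃ n₄ (n₁ + n₅) ∧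
        edgeTypeColour (n₁ + n₃) (n₂ + n₄) n₅ = edgeTypeColour n₁ n₂ (n₃ + n₅) ∧
        edgeTypeColour (n₁ + n₃) (n₂ + n₄) n₅ = edgeTypeColour n₂ n₁ (n₄ + n₅) ∧
        edgeTypeColour (n₁ + n₃) (n₂ + n₄) n₅ = edgeTypeColour n₄ n₃ (n₂ + n₅) ∧
        edgeTypeColour (n₁ + n₃) (n₂ + n₄) n₅ = edgeTypeColour (n₁ + n₄) (n₂ + n₃) n₅) := by
  decide +kernel

/-- A zero-sum dependence between four vertices of a cube must be supported by `±(1, 1, -1, -1)`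
up to the order of the entries: each pair of entries is separated by a zero-sum subset. -/
theorem eq_neg_of_separated {w x y z : ℝ} (hsum : w + x + y + z = 0)
    (hne : ¬ (x = 0 ∧ y = 0 ∧ z = 0))
    (hwx : w = 0 ∨ x = 0 ∨ w + y = 0 ∨ w + z = 0)
    (hwy : w = 0 ∨ y = 0 ∨ w + x = 0 ∨ w + z = 0)
    (hwz : w = 0 ∨ z = 0 ∨ w + x = 0 ∨ w + y = 0)
    (hxy : x = 0 ∨ y = 0 ∨ x + w = 0 ∨ x + z = 0)
    (hxz : x = 0 ∨ z = 0 ∨ x + w = 0 ∨ x + y = 0)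
    (hyz : y = 0 ∨ z = 0 ∨ y + w = 0 ∨ y + x = 0) :
    w ≠ 0 ∧ ((x = w ∧ y = -w ∧ z = -w) ∨ (x = -w ∧ y = w ∧ z = -w) ∨
      (x = -w ∧ y = -w ∧ z = w)) := by
  grind (splits := 30)

theorem exists_dependence_of_coplanar {V : Type*} [AddCommGroup V] [Module ℝ V] {a b d e : V}
    (h : Coplanar ℝ ({a, b, d, e} : Set V)) :
    ∃ w x y z : ℝ, w + x + y + z = 0 ∧ ¬ (x = 0 ∧ y = 0 ∧ z = 0) ∧
      w • a + x • b + y • d + z • e = 0 := by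
  have hdep : ¬ LinearIndependent ℝ ![b - a, d - a, e - a] := by
    intro hli
    have hle : Submodule.span ℝ (Set.range ![b - a, d - a, e - a]) ≤
        vectorSpan ℝ ({a, b, d, e} : Set V) := by
      rw [Submodule.span_le]
      rintro _ ⟨i, rfl⟩
      fin_cases i <;> exact vsub_mem_vectorSpan ℝ (by simp) (by simp)
    have := finiteDimensional_vectorSpan_of_finite ℝ (Set.toFinite ({a, b, d, e} : Set V))
    have hrank := (Submodule.finrank_mono hle).trans h.finrank_le_two
    rw [finrank_span_eq_card hli] at hrank
    norm_num at hrank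
  obtain ⟨g, hg, i, hi⟩ := Fintype.not_linearIndependent_iff.mp hdep
  refine ⟨-(g 0 + g 1 + g 2), g 0, g 1, g 2, by ring, ?_, ?_⟩
  · rintro ⟨h₀, h₁, h₂⟩
    fin_cases i <;> contradiction
  · rw [← hg]
    simp only [Fin.sum_univ_three, Matrix.cons_val]
    module

theorem add_eq_add_of_coplanar {n : ℕ} {a b d e : Fin n → Bool}
    (hab : a ≠ b) (had : a ≠ d) (hae : a ≠ e) (hbd : b ≠ d) (hbe : b ≠ e) (hde : d ≠ e)
    (h : Coplanar ℝ ({toPoint n a, toPoint n b, toPoint n d, toPoint n e} : Set (Fin n → ℝ))) :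
    (∀ i, (a i).toNat + (b i).toNat = (d i).toNat + (e i).toNat) ∨
    (∀ i, (a i).toNat + (d i).toNat = (b i).toNat + (e i).toNat) ∨
    (∀ i, (a i).toNat + (e i).toNat = (b i).toNat + (d i).toNat) := by
  obtain ⟨w, x, y, z, hsum, hne, hzero⟩ := exists_dependence_of_coplanar h
  have hcoord (i : Fin n) : (if a i then w else 0) + (if b i then x else 0) +
      (if d i then y else 0) + (if e i then z else 0) = 0 := by
    simpa [toPoint] using congrFun hzero i
  have key : w ≠ 0 ∧ ((x = w ∧ y = -w ∧ z = -w) ∨ (x = -w ∧ y = w ∧ z = -w) ∨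
      (x = -w ∧ y = -w ∧ z = w)) := by
    apply eq_neg_of_separated hsum hne
    · obtain ⟨i, hi⟩ := Function.ne_iff.mp hab
      have := hcoord i
      grind
    · obtain ⟨i, hi⟩ := Function.ne_iff.mp had
      have := hcoord i
      grind
    · obtain ⟨i, hi⟩ := Function.ne_iff.mp hae
      have := hcoord i
      grind
    · obtain ⟨i, hi⟩ := Function.ne_iff.mp hbd
      have := hcoord i
      grind
    · obtain ⟨i, hi⟩ := Function.ne_iff.mp hbe
      have := hcoord i
      grind
    · obtain ⟨i, hi⟩ := Function.ne_iff.mp hde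
      have := hcoord i
      grind
  obtain ⟨hw, ⟨rfl, rfl, rfl⟩ | ⟨rfl, rfl, rfl⟩ | ⟨rfl, rfl, rfl⟩⟩ := key
  · left
    intro i
    have := hcoord i
    generalize a i = α, b i = β, d i = δ, e i = ε at this ⊢
    cases α <;> cases β <;> cases δ <;> cases ε <;> simp at this ⊢ <;> grind
  · right; left
    intro i
    have := hcoord i
    generalize a i = α, b i = β, d i = δ, e i = ε at this ⊢
    cases α <;> cases β <;> cases δ <;> cases ε <;> simp at this ⊢ <;> grind
  · right; right
    intro i
    have := hcoord i
    generalize a i = α, b i = β, d i = δ, e i = ε at this ⊢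
    cases α <;> cases β <;> cases δ <;> cases ε <;> simp at this ⊢ <;> grind

theorem typeColouring_not_mono_of_add_eq_add {a b d e : Fin 9 → Bool}
    (had : a ≠ d) (hae : a ≠ e)
    (h : ∀ i, (a i).toNat + (b i).toNat = (d i).toNat + (e i).toNat) :
    ¬ (typeColouring 9 s(a, b) = typeColouring 9 s(a, d) ∧
      typeColouring 9 s(a, b) = typeColouring 9 s(a, e) ∧
      typeColouring 9 s(a, b) = typeColouring 9 s(b, d) ∧
      typeColouring 9 s(a, b) = typeColouring 9 s(b, e) ∧
      typeColouring 9 s(a, b) = typeColouring 9 s(d, e)) := by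
  let N (p q r s : Bool) : ℕ :=
    (Finset.univ.filter fun i => a i = p ∧ b i = q ∧ d i = r ∧ e i = s).card
  have hbound : N true false true false + N false true false true + N true false false true +
      N false true true false + N true true true true ≤ 9 := by
    calc _ ≤ ∑ _i : Fin 9, 1 := by
          simp only [N, Finset.card_filter, ← Finset.sum_add_distrib]
          refine Finset.sum_le_sum fun i _ => ?_
          generalize a i = α, b i = β, d i = δ, e i = ε
          decide +revert
      _ = 9 := by simp
  have hcount (P : Bool → Bool → Bool → Bool → Bool) :
      (Finset.univ.filter fun i => P (a i) (b i) (d i) (e i) = true).card =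
        (P true false true false).toNat * N true false true false +
        (P false true false true).toNat * N false true false true +
        (P true false false true).toNat * N true false false true +
        (P false true true false).toNat * N false true true false +
        (P true true true true).toNat * N true true true true +
        (P false false false false).toNat * N false false false false := by
    simp only [N, Finset.card_filter, Finset.mul_sum, ← Finset.sum_add_distrib]
    refine Finset.sum_congr rfl fun i _ => ?_
    have hi := h i
    generalize a i = α, b i = β, d i = δ, e i = ε at hi ⊢
    cases α <;> cases β <;> cases δ <;> cases ε <;> simp [Bool.toNat, Bool.cond_eq_ite] at hi ⊢
  have hae' : N true false true false + N false true false true ≠ 0 := by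
    obtain ⟨i, hi⟩ := Function.ne_iff.mp hae
    have hi' := h i
    simp only [N, ne_eq, Nat.add_eq_zero_iff, Finset.card_eq_zero, Finset.filter_eq_empty_iff]
    rintro ⟨h₁, h₂⟩
    specialize @h₁ i (Finset.mem_univ i)
    specialize @h₂ i (Finset.mem_univ i)
    revert hi hi' h₁ h₂
    generalize a i = α, b i = β, d i = δ, e i = ε
    decide +revert
  have had' : N true false false true + N false true true false ≠ 0 := by
    obtain ⟨i, hi⟩ := Function.ne_iff.mp had
    have hi' := h i
    simp only [N, ne_eq, Nat.add_eq_zero_iff, Finset.card_eq_zero, Finset.filter_eq_empty_iff]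
    rintro ⟨h₁, h₂⟩
    specialize @h₁ i (Finset.mem_univ i)
    specialize @h₂ i (Finset.mem_univ i)
    revert hi hi' h₁ h₂
    generalize a i = α, b i = β, d i = δ, e i = ε
    decide +revert
  have key := edgeTypeColour_parallelogram
    (N true false true false) (by omega) (N false true false true) (by omega)
    (N true false false true) (by omega) (N false true true false) (by omega)
    (N true true true true) (by omega) hae' had'
  have cab := hcount fun α β _ _ => α && !β
  have cba := hcount fun α β _ _ => β && !α
  have cab₁ := hcount fun α β _ _ => α && β
  have cad := hcount fun α _ δ _ => α && !δ
  have cda := hcount fun α _ δ _ => δ && !α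
  have cad₁ := hcount fun α _ δ _ => α && δ
  have cae := hcount fun α _ _ ε => α && !ε
  have cea := hcount fun α _ _ ε => ε && !α
  have cae₁ := hcount fun α _ _ ε => α && ε
  have cbd := hcount fun _ β δ _ => β && !δ
  have cdb := hcount fun _ β δ _ => δ && !β
  have cbd₁ := hcount fun _ β δ _ => β && δ
  have cbe := hcount fun _ β _ ε => β && !ε
  have ceb := hcount fun _ β _ ε => ε && !β
  have cbe₁ := hcount fun _ β _ ε => β && ε
  have cde := hcount fun _ _ δ ε => δ && !ε
  have ced := hcount fun _ _ δ ε => ε && !δ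
  have cde₁ := hcount fun _ _ δ ε => δ && ε
  simp only [Bool.and_eq_true, Bool.not_eq_true', Bool.not_true, Bool.not_false, Bool.and_true,
    Bool.and_false, Bool.toNat_true, Bool.toNat_false, zero_mul, one_mul, zero_add, add_zero] at *
  simp only [typeColouring_mk, cab, cba, cab₁, cad, cda, cad₁,
    cae, cea, cae₁, cbd, cdb, cbd₁,
    cbe, ceb, cbe₁, cde, ced, cde₁]
  exact key

theorem exists_S9_invariant_good_colouring :
    ∃ c : Sym2 (Fin 9 → Bool) → Bool, NoMonoPlanarK4 9 c ∧
      ∀ σ : Equiv.Perm (Fin 9), ∀ u v : Fin 9 → Bool, u ≠ v →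
        c s(permAct 9 σ u, permAct 9 σ v) = c s(u, v) := by
  refine ⟨typeColouring 9, ?_, fun σ u v _ => typeColouring_permAct 9 σ u v⟩
  intro a b d e hab had hae hbd hbe hde hcop hmono
  obtain ⟨h₁, h₂, h₃, h₄, h₅⟩ := hmono
  rcases add_eq_add_of_coplanar hab had hae hbd hbe hde hcop with h | h | h
  · exact typeColouring_not_mono_of_add_eq_add had hae h ⟨h₁, h₂, h₃, h₄, h₅⟩
  · refine typeColouring_not_mono_of_add_eq_add hab hae h ?_
    rw [Sym2.eq_swap (a := d) (b := b)]
    grind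
  · refine typeColouring_not_mono_of_add_eq_add hab had h ?_
    rw [Sym2.eq_swap (a := e) (b := b), Sym2.eq_swap (a := e) (b := d)]
    grind
end

section
/- There exists a 2-colouring of K(C_10) containing no monochromatic planar K_4 that is invariant under the subgroup of permutations of the 10 coordinates generated by the permutations (1 5 7)(2 9 4)(3 8 10) and (1 8)(2 5 6 3)(4 9 7 10) (a copy of S_5, of order 120, acting primitively on the 10 coordinates). -/
/-- The colouring `c` is invariant under the subgroup `G` of coordinate permutations. -/
def InvariantUnder (n : ℕ) (G : Subgroup (Equiv.Perm (Fin n)))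
    (c : Sym2 (Fin n → Bool) → Bool) : Prop :=
  ∀ σ ∈ G, ∀ u v : Fin n → Bool, u ≠ v →
    c s(permAct n σ u, permAct n σ v) = c s(u, v)

/-- The permutation `(1 5 7)(2 9 4)(3 8 10)` of the 10 coordinates (0-indexed). -/
def g1 : Equiv.Perm (Fin 10) := (([0, 4, 6] : List (Fin 10)).formPerm) * (([1, 8, 3] : List (Fin 10)).formPerm) * (([2, 7, 9] : List (Fin 10)).formPerm)

/-- The permutation `(1 8)(2 5 6 3)(4 9 7 10)` of the 10 coordinates (0-indexed). -/
def g2 : Equiv.Perm (Fin 10) := (([0, 7] : List (Fin 10)).formPerm) * (([1, 4, 5, 2] : List (Fin 10)).formPerm) * (([3, 8, 6, 9] : List (Fin 10)).formPerm)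

/-- `f N`, arranged so that the kernel computes `N` to a literal before unfolding `f`. -/
def withValue {α : Type*} (N : ℕ) (f : ℕ → α) : α :=
  match N with
  | 0 => f 0
  | k + 1 => f (k + 1)

@[simp]
theorem withValue_eq {α : Type*} (N : ℕ) (f : ℕ → α) : withValue N f = f N := by
  cases N <;> rfl

/-- A left fold over a list whose accumulator is computed at each step. -/
def strictFoldl {α : Type*} (f : ℕ → α → ℕ) : List α → ℕ → ℕ
  | [], N => N
  | a :: l, N => withValue (f N a) (strictFoldl f l)

/-- The natural number `N`, read as the truth table of a Boolean function of `m` variables,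
evaluated at `w`. -/
def bitOf {m : ℕ} (N : ℕ) (w : Fin m → Bool) : Bool := N.testBit (Nat.ofBits w)

/-- The truth table of the `i`-th variable among `m`. -/
def coordTable : ℕ → ℕ → ℕ
  | 0, _ => 0
  | m + 1, i =>
    if i = m then (2 ^ 2 ^ m - 1) <<< 2 ^ m
    else withValue (coordTable m i) fun V => V ||| V <<< 2 ^ m

/-- The truth table of a constant function of `m` variables. -/
def constTable (m : ℕ) (b : Bool) : ℕ := bif b then 2 ^ 2 ^ m - 1 else 0

/-- Negate the `i`-th variable in a truth table. -/
def flipTable {m : ℕ} (i : Fin m) (N : ℕ) : ℕ :=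
  (N &&& coordTable m i) >>> 2 ^ i.val ||| N <<< 2 ^ i.val &&& coordTable m i

/-- The truth table which agrees with `A` where `c` holds and with `B` elsewhere. -/
def muxTable (c A B : ℕ) : ℕ := B ^^^ (c &&& (A ^^^ B))

/-- Negate the `i`-th variable in a truth table wherever `c` holds. -/
def condFlipTable {m : ℕ} (c : ℕ) (i : Fin m) (N : ℕ) : ℕ :=
  if c = 0 then N else muxTable c (flipTable i N) N

/-- Exchange two variables in a truth table. -/
def swapTable {m : ℕ} (i j : Fin m) (N : ℕ) : ℕ :=
  withValue (flipTable j N) fun M =>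
    muxTable (coordTable m i ^^^ coordTable m j) (flipTable i M) N

/-- Permute the variables in a truth table by a product of transpositions. -/
def permTable {m : ℕ} : List (Fin m × Fin m) → ℕ → ℕ
  | [], N => N
  | p :: l, N => withValue (permTable l N) (swapTable p.1 p.2)

/-- Negate each variable `e i` in a truth table wherever `c i` holds. -/
def flipAll {n m : ℕ} (e : Fin n → Fin m) (c : Fin n → ℕ) (N : ℕ) : ℕ :=
  strictFoldl (fun N i => condFlipTable (c i) (e i) N) (List.finRange n) N

/-- The union of a family of truth tables. -/
def unionTable {n : ℕ} (c : Fin n → ℕ) : ℕ :=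
  strictFoldl (fun N i => N ||| c i) (List.finRange n) 0

/-- Enlarge a truth table successively by its images under the given products of
transpositions. -/
def saturate {m : ℕ} (L : List (List (Fin m × Fin m))) (N : ℕ) : ℕ :=
  strictFoldl (fun N l => N ||| permTable l N) L N

/-- The product of a list of transpositions. -/
def permOfSwaps {m : ℕ} (l : List (Fin m × Fin m)) : Equiv.Perm (Fin m) :=
  (l.map fun p => Equiv.swap p.1 p.2).prod

/-- The transpositions of `l` acting on both halves of `n + n` variables. -/
def diagonalSwaps {n : ℕ} (l : List (Fin n × Fin n)) : List (Fin (n + n) × Fin (n + n)) :=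
  l.flatMap fun p =>
    [(Fin.castAdd n p.1, Fin.castAdd n p.2), (Fin.natAdd n p.1, Fin.natAdd n p.2)]

/-- The table of `(u, x) ↦ N (u + x, x)`. -/
def reflectTable (n N : ℕ) : ℕ :=
  flipAll (Fin.castAdd n) (fun i : Fin n => coordTable (n + n) (Fin.natAdd n i)) N

/-- The table of `(u, x) ↦ N (u + y, x)`. -/
def translateLeft {n : ℕ} (y : Fin n → Bool) (N : ℕ) : ℕ :=
  flipAll (Fin.castAdd n) (fun i => constTable (n + n) (y i)) N

/-- The table of `(u, x) ↦ N (u, x + y)`. -/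
def translateRight {n : ℕ} (y : Fin n → Bool) (N : ℕ) : ℕ :=
  flipAll (Fin.natAdd n) (fun i => constTable (n + n) (y i)) N

/-- The table of `(u, x) ↦ N (u, y)`. -/
def restrictRight {n : ℕ} (y : Fin n → Bool) (N : ℕ) : ℕ :=
  flipAll (Fin.natAdd n)
    (fun i => coordTable (n + n) (Fin.natAdd n i) ^^^ constTable (n + n) (y i)) N

/-- The table of those `(u, x)` with `x` nonzero and disjoint from `y`. -/
def disjointTable {n : ℕ} (y : Fin n → Bool) : ℕ :=
  muxTable
    (unionTable fun i : Fin n => coordTable (n + n) (Fin.natAdd n i) &&& constTable (n + n) (y i)) 0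
    (unionTable fun i : Fin n => coordTable (n + n) (Fin.natAdd n i))

/-- Whether no rectangle with vertices `u`, `u + x`, `u + y`, `u + x + y`, where `x` is nonzero
and disjoint from `y`, is monochromatic for the colouring `(u, u + x) ↦ N (u, x)`. -/
def rectangleCheck {n : ℕ} (N : ℕ) (y : Fin n → Bool) : Bool :=
  withValue (translateLeft y N) fun A =>
  withValue (translateRight y N) fun D =>
  withValue (translateLeft y D) fun D' =>
  withValue (restrictRight y N) fun B =>
  withValue (reflectTable n B) fun B' =>
  withValue (disjointTable y) fun G =>
    Nat.beq (G &&& (N &&& A &&& D &&& D' &&& B &&& B')) 0 &&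
      Nat.beq (G &&& (N ||| A ||| D ||| D' ||| B ||| B')) G

/-- The generator `g1` as a product of transpositions. -/
def swaps1 : List (Fin 10 × Fin 10) := [(0, 4), (4, 6), (1, 8), (8, 3), (2, 7), (7, 9)]

/-- The generator `g2` as a product of transpositions. -/
def swaps2 : List (Fin 10 × Fin 10) :=
  [(0, 7), (1, 4), (4, 5), (5, 2), (3, 8), (8, 6), (6, 9)]

/-- An alternating word in the two generators. -/
def saturationWord : List (List (Fin 10 × Fin 10)) :=
  [swaps2, swaps1, swaps2, swaps1, swaps2, swaps1, swaps2, swaps1, swaps2, swaps1]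

/-- For each representative `x` of an orbit of nonzero directions, the truth table of
`u ↦ c(u, u + x)`. -/
def directionRows : List (ℕ × ℕ) := [
  (1, 137106984493651715661544510981622566172539885330371529938805363363576805549151679569670266481051364754480954748171170824411995270276755748249401308985810221156770766133843471478218104351419722245150338903816184037337983672226081628223587419518940233472125816121797649696387432883024521019549675030734254883644),
  (3, 105614573886510207597139741209470559002619745593712496408508398518878604015687283518161784873167508017529532506935523469694822712192536590787475821393910106375316488170658522859240864721743400142637256885941571864040909304357397081681493068684721797896784495946660070428820381665983123128403651668431494093206),
  (7, 90942376066067582894478105981734389870694863832387792859143917907337396796271209107137235154826608782012339843210489965426049149852532392618190874890888425213174353072120553016922238043988579202846724754067422365700780940907545786638679883396552744057492735410077416374786611676406542074265479630697690857086),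
  (15, 1097222844063974601044922213353562063626598710550810377738034784568052841650929125334717908520287896291346027240948820239758517193403253228184347215704425593287635056254851794895539478119515309907607771918202079242154862813096615927333650466211213053333688733237379384782733240759385391173770726352688744),
  (19, 174521676032431831778575484993903426721749601443257491270574671037028030698522518709783810610240007967378886319928353031142475849983419030109459848825828113977146997435036599852954919193387448282761673029480019076881234483272498748615864997645978813504005284944745315877260333520200019250168122414281490194705),
  (20, 158061046082987140283808113366888070957400940860737778429187837203285646174274049579482969847352173857175450722975091452655198787056586236049801601449952222072797681266299259213355967225720914139735190346457685064107820486392073416466999268858189176787126016263853137026633257138146384572163421624150231325174),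
  (21, 132088802582948901109587398778720678209437644901489111252400673401778264617776929816670608530425719805166509895093355926024354604337439523632060586668501283552898307297951191867126071590096052901023714143560944861076911529208016825296246554972946095714220856240420716014356562327595867035293021532131066704142),
  (23, 73297601992051598850518196353243869840169509717610379142628445191783856883471907635372857707248653471730487106095606800412995483771850399179785987922181807070361002492321013397998775941226172897885704495181992825046901750293209014779438415072660487661260757939940937338882903956015419121904143956838987143049),
  (28, 95110441404676779000093038801106159206329179519720187549385559374709902837174411163596243239632757561220495655753318985927656630512786922105573387383244704410012188109534348711461448189881017178711955413684134978405060961847011101597729087727765613302127047191976521287989031462815636231080654726425924866038),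
  (29, 73385527433169198639493112880604909197798346467991176147269150186988678157960700109669264336901796358827873286642432017915982176485860042311290187325602132934427216637909930365559173230783934389621355092815163825213906422336637391224563170393806082035942749178919976358013216299998107969531008528994081515108),
  (31, 73382407213297250180645412253635064924509786689974400313949873276169649902399958682234712497898304946278878400357136908550362164007535023894302427650052230860346889223260564382930312940597459624849074454130791189786250943158218844708423616173609047839142534193832330716865305285982160329301429455069679455968),
  (54, 91818908507417321289580874308609726718729473473242267234940413507942025705363221846233208948856162635377326529085692745264114775965100910941977734724124570462159313298368690388858396105525350865760099163970682229082734726065576406689075614669904159720090532250130971091533845399267357698716637495475527892520),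
  (55, 73562087014707714626462802571254655263724211638053754152715024696357975322141802540779306513789151209896354159875803416754408849096752985979106502532668801518926197001723102118778561638271889660307539837988138233186363935670419068188192556862848331936070827194732345802155499362464074203346502403455524607957),
  (58, 55067576595979532081604557542150636500628864288142484800090044402452482363939196755525179306263574637574511230767491208611659883402050984883095073772085719973925499015572964842167078412421057616025120466293215293830428198702366619950012430839092610481119782095724362150532260799516600124686464274965958287425),
  (59, 30051864940395774757675163685573534731697416096723016703118549140310966105229047083702893613137694645167950019366486982888094947547673182822419217056110372679306636184068576186293349467972967038246875320012102778895311719984234906275421663338691214029680742544405032252589570935092192143762437026711793311249),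
  (62, 89009192518109805391817746644892426128985512717111563688157293303858936749368761165426364319922975580416611976641437668155155658204384372357930593294977078808611700409099313770385761528639842412023262483571556136480800805403603635433342263056589107959777656606092658224926179878214521343034196975686371328705),
  (63, 89711260192629735336112602026233332069661607496649825110933147521938901992845292301636195116983741353269441621540914273034173719603725433411679650144136372938798288549591308065272697764187380096754666992473931380222093184635713004423164606304404672000487197040290310539739626073779115381504726922634263849601),
  (126, 89119102137668227103882152785408497962424822665896459560926910311058378827135262531612128809789779866444899262158964680648017006448922171913839730913440356746812840197829863773713474227946228439291347333994658700499379956175049967703482146057217401154864233726684620275550094800717098780970406961991796282985),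
  (127, 14986170378913562751073857614506846308770077065728875149566073238391851732893675583859210965215475849658966801661449452365809786287347077124448996238598748544508560881328738112722534700514016917507979766093277444132805340350356915082584629233654237112215436681332333845478760760697575697842318952418846326505),
  (183, 15801172757857416001113029547263895232767805009626174713299249827116712223753759839723423168349947187963281612833158728423507223116894191516397665383064432940145044785591946871469607243706654350423994693706971019043919421569694565451740774058787299134637918064784207084448618334196069516192775082037795186711),
  (184, 15451587027004408409539819399381108977551620776123158791105591626221533099183518272488229569164697298013494679598543246953950020997763716162433147801380047567650212913916614432310938103199357761652946686038252530266818239591651261973407469859369880158671250553103197460246531082328912579320973088153013747326),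
  (185, 74846860754123607472616127866015449104774600064711140634354410170527080018757887512974802983397877531124026569340466410934111027398306963597760830606060867202010544923236012728060239589751428248366345992083866035648949521907471668055774403468163585662070337862574489001731242708275634962272999386626235710505),
  (187, 73035157721106036656632726364588485357410843884935229161754091739122391054835801914043736694352503345589102328494430782187260550220242330869732653248998085380374275863688391341480365745272797408522244251755353520444600640128719858755510336542054967161099887422445537366984161001047252927802869986630365480577),
  (191, 89529581296388513888245729618495993666518788445998663633322544118409511946435686307758225962653394938987681913363906194703297703207502070821909492547714482761820632141984860186097859113733655186048421259818167365642903405004341981097739285109948722703308565834680621572765236424707141236086701508032117735784),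
  (207, 89884449764971396592394110203348910026156521048752609229169349231598848411969197760253425506540191518773953192627052251919320472940695047669974326502376395685981524170110834292799196810961648868039920838313010550218200035285737236092676848435544661101741423011251702990323942439132725298411119724770612411561),
  (220, 176086855582030859952566642960793677545384716015701847904505673130174361688930379661667348424341462070300916140936149429285130876437648760300325855056045212620932347587474766586384405483406810096735201876333448186688221542783804985389949340348402400636813516319249588644458697407650737508361944842864272237600),
  (221, 41196725541674733898185693383298303137666193557578417749734132554888478517338005662597039043093664444136377646460181212340349656122278737626530039803624510637612782119442823237568828176208308164962697434417001099508092903037447651974953250388595927883641812255615785762849351444363519666325630072022993738185),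
  (223, 165616153722914826211242815053595608718779532330746019408824247974344607791163385965046666961187883906352565300127056935920958442971403941659332990485747124098337982024223567032087120358353055121394586743927677219558854191497528966093908788374602140063875489709804069522485424133392751889262014373392877058177),
  (254, 15809271690670308870716564790447397828762336534894446386590443641081903875057711567486664471997133425123324621469873965684973196532438054336347991990317314002916610351422448581833460253252354880415871929771679392546370595327481071544211221198549585227382343036098725675874138634443815638069436312008079605225),
  (255, 90998420169845669637451195661719773208418086030915699354919613147407999706154570823076719882944969560017396412676636811129097158937546836455384513560889717617575517511377645581054245490851611924128576474252737595382032506542944857653276884661432720430242285067619290418732614676417621451375073387717843588887),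
  (495, 106381615287030991218813455788463020610577651439526142266819596771812600210926218634802794676606771661515455781899142460060283914875286030582722470371708654690003226593273331849311592549977286373567168780747225747165867169753702922149255502971251171852228698034121865840667564627262482653526918772350968661600),
  (511, 164034001008048098843530216161458616077980000526609168228089182307248895141625281629241729459406551160819480333445537452093695760936459581860215911446400671856883563357954195265052899672680203396199332371554033903225750089949179262157537957562395546190745595290091758979050186234454702699363501777318192479974),
  (1023, 16500820707453879900716114791696537995248616790704378035483203268578506531279487684653899349829335780348616286918885614904979415749688462096889430818515191249758593992049958039228439122711648309103306650905973809351526382526102388474454322703442325992157668483225766588406988445341038325785273690494261460712)]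

/-- The truth table of `(u, x) ↦ c(u, u + x)`. -/
def colourTable : ℕ :=
  saturate (saturationWord.map diagonalSwaps)
    (strictFoldl (fun N r => N ||| r.2 <<< (1024 * r.1)) directionRows 0)

/-- The invariances of a colour table, together with the absence of monochromatic rectangles in
the representative directions. -/
def tableCheck (N : ℕ) : Bool :=
  Nat.beq (permTable (diagonalSwaps swaps1) N) N &&
  Nat.beq (permTable (diagonalSwaps swaps2) N) N &&
  Nat.beq (reflectTable 10 N) N &&
  directionRows.all fun r => rectangleCheck N fun i : Fin 10 => r.1.testBit i

theorem tableCheck_colourTable : withValue colourTable tableCheck = true := by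
  decide +kernel

/-- The set of representative directions. -/
def representatives : ℕ := strictFoldl (fun N r => N ||| 1 <<< r.1) directionRows 0

theorem saturate_representatives :
    saturate saturationWord representatives = 2 ^ 2 ^ 10 - 2 := by
  decide +kernel

theorem strictFoldl_eq_foldl {α : Type*} (f : ℕ → α → ℕ) (l : List α) (N : ℕ) :
    strictFoldl f l N = l.foldl f N := by
  induction l generalizing N with
  | nil => rfl
  | cons a l ih => simp [strictFoldl, ih]

theorem testBit_coordTable (m i k : ℕ) :
    (coordTable m i).testBit k = (decide (k < 2 ^ m) && k.testBit i) := by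
  induction m generalizing k with
  | zero =>
    rcases Nat.eq_zero_or_pos k with rfl | hk
    · simp [coordTable]
    · simp [coordTable, hk.ne']
  | succ m ih =>
    have hp : 2 ^ (m + 1) = 2 ^ m + 2 ^ m := by ring
    by_cases hk : k < 2 ^ m
    · have hk' : k < 2 ^ (m + 1) := by omega
      rw [coordTable]
      split_ifs with him
      · subst him
        simp [Nat.testBit_lt_two_pow hk, Nat.not_le.2 hk]
      · simp [ih, hk, hk', Nat.not_le.2 hk]
    · obtain ⟨r, rfl⟩ := Nat.exists_eq_add_of_le (Nat.le_of_not_lt hk)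
      have hr : 2 ^ m + r < 2 ^ (m + 1) ↔ r < 2 ^ m := by omega
      rw [coordTable]
      split_ifs with him
      · subst him
        by_cases h : r < 2 ^ i
        · simp [hr, h, Nat.testBit_two_pow_add_eq, Nat.testBit_lt_two_pow h]
        · simp [hr, h]
      · by_cases h : r < 2 ^ m
        · rcases Nat.lt_or_gt_of_ne him with him | him
          · simp [ih, hr, h, Nat.testBit_two_pow_add_gt him]
          · have h1 : 2 ^ (m + 1) ≤ 2 ^ i := Nat.pow_le_pow_right (by norm_num) him
            rw [Nat.testBit_lt_two_pow (show 2 ^ m + r < 2 ^ i by omega)]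
            simp [ih, Nat.testBit_lt_two_pow (show r < 2 ^ i by omega)]
        · simp [ih, hr, h]

theorem ofBits_update_true {m : ℕ} (w : Fin m → Bool) (i : Fin m) (h : w i = false) :
    Nat.ofBits (Function.update w i true) = Nat.ofBits w + 2 ^ i.val := by
  induction m with
  | zero => exact i.elim0
  | succ m ih =>
    rw [Nat.ofBits_succ, Nat.ofBits_succ]
    cases i using Fin.cases with
    | zero =>
      have : Function.update w 0 true ∘ Fin.succ = w ∘ Fin.succ := by
        ext j; simp [Function.update, Fin.succ_ne_zero]
      simp [this, h]
    | succ j =>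
      have : Function.update w j.succ true ∘ Fin.succ
          = Function.update (w ∘ Fin.succ) j true := by
        ext a; simp [Function.update, Fin.succ_inj]
      rw [this, ih _ _ h, Function.update_of_ne (Fin.succ_ne_zero j).symm, Fin.val_succ]
      ring

section

variable {m n : ℕ}

@[simp]
theorem bitOf_zero (w : Fin m → Bool) : bitOf 0 w = false := by simp [bitOf]

@[simp]
theorem bitOf_and (A B : ℕ) (w : Fin m → Bool) :
    bitOf (A &&& B) w = (bitOf A w && bitOf B w) := by simp [bitOf]

@[simp]
theorem bitOf_or (A B : ℕ) (w : Fin m → Bool) :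
    bitOf (A ||| B) w = (bitOf A w || bitOf B w) := by simp [bitOf]

@[simp]
theorem bitOf_xor (A B : ℕ) (w : Fin m → Bool) :
    bitOf (A ^^^ B) w = (bitOf A w ^^ bitOf B w) := by simp [bitOf]

@[simp]
theorem bitOf_coordTable (i : Fin m) (w : Fin m → Bool) : bitOf (coordTable m i) w = w i := by
  simp [bitOf, testBit_coordTable, Nat.ofBits_lt_two_pow]

@[simp]
theorem bitOf_constTable (b : Bool) (w : Fin m → Bool) : bitOf (constTable m b) w = b := by
  cases b <;> simp [bitOf, constTable, Nat.ofBits_lt_two_pow]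

@[simp]
theorem bitOf_muxTable (c A B : ℕ) (w : Fin m → Bool) :
    bitOf (muxTable c A B) w = if bitOf c w then bitOf A w else bitOf B w := by
  simp only [muxTable, bitOf_xor, bitOf_and]
  cases bitOf c w <;> cases bitOf A w <;> cases bitOf B w <;> rfl

theorem bitOf_flipTable (i : Fin m) (N : ℕ) (w : Fin m → Bool) :
    bitOf (flipTable i N) w = bitOf N (Function.update w i (!w i)) := by
  cases h : w i with
  | false =>
    have hV : (coordTable m i).testBit (Nat.ofBits (Function.update w i true)) = true := by
      simpa [bitOf] using bitOf_coordTable i (Function.update w i true)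
    rw [ofBits_update_true w i h] at hV
    have hV' : (coordTable m i).testBit (Nat.ofBits w) = false := by
      simpa [bitOf, h] using bitOf_coordTable i w
    simp [bitOf, flipTable, ofBits_update_true w i h, hV', Nat.add_comm (2 ^ i.val), hV]
  | true =>
    obtain ⟨w', hw', rfl⟩ : ∃ w', w' i = false ∧ w = Function.update w' i true :=
      ⟨Function.update w i false, by simp, by simp [← h]⟩
    have hV : (coordTable m i).testBit (Nat.ofBits w' + 2 ^ i.val) = true := by
      rw [← ofBits_update_true w' i hw']
      simpa [bitOf] using bitOf_coordTable i (Function.update w' i true)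
    have hV' : (coordTable m i).testBit (2 ^ i.val + (Nat.ofBits w' + 2 ^ i.val)) = false := by
      rw [testBit_coordTable, Nat.testBit_two_pow_add_eq, Nat.add_comm (Nat.ofBits w'),
        Nat.testBit_two_pow_add_eq]
      simp [hw']
    have hw : Function.update w' i false = w' := by simp [← hw']
    simp [bitOf, flipTable, ofBits_update_true w' i hw', hV, hV', hw]

theorem bitOf_condFlipTable (c : ℕ) (i : Fin m) (N : ℕ) (w : Fin m → Bool) :
    bitOf (condFlipTable c i N) w = bitOf N (Function.update w i (w i ^^ bitOf c w)) := by
  rw [condFlipTable]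
  split_ifs with hc
  · simp [hc]
  · rw [bitOf_muxTable, bitOf_flipTable]
    cases bitOf c w <;> simp

theorem bitOf_swapTable (i j : Fin m) (N : ℕ) (w : Fin m → Bool) :
    bitOf (swapTable i j N) w = bitOf N (w ∘ Equiv.swap i j) := by
  have key : (if (w i ^^ w j) then
      Function.update (Function.update w i (!w i)) j (!Function.update w i (!w i) j) else w)
        = w ∘ Equiv.swap i j := by
    rcases eq_or_ne i j with rfl | hij
    · simp
    · ext k
      rcases eq_or_ne k j with rfl | hkj
      · cases hi : w i <;> cases hk : w k <;> simp [hij.symm, hi, hk]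
      · rcases eq_or_ne k i with rfl | hki
        · cases hi : w j <;> cases hk : w k <;> simp [hij, hi, hk]
        · rw [Function.comp_apply, Equiv.swap_apply_of_ne_of_ne hki hkj]
          split_ifs <;> simp [hkj, hki]
  rw [← key, swapTable, withValue_eq, bitOf_muxTable, bitOf_flipTable, bitOf_flipTable]
  simp only [bitOf_xor, bitOf_coordTable]
  split_ifs <;> rfl

theorem bitOf_permTable (l : List (Fin m × Fin m)) (N : ℕ) (w : Fin m → Bool) :
    bitOf (permTable l N) w = bitOf N (w ∘ permOfSwaps l) := by
  induction l generalizing w with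
  | nil => simp [permTable, permOfSwaps]
  | cons p l ih =>
    rw [permTable, withValue_eq, bitOf_swapTable, ih]
    simp [permOfSwaps, Function.comp_assoc]

theorem append_comp_permOfSwaps (l : List (Fin n × Fin n)) (u x : Fin n → Bool) :
    Fin.append u x ∘ permOfSwaps (diagonalSwaps l)
      = Fin.append (u ∘ permOfSwaps l) (x ∘ permOfSwaps l) := by
  induction l generalizing u x with
  | nil => simp [permOfSwaps, diagonalSwaps]
  | cons p l ih =>
    have hp : Fin.append u x ∘ Equiv.swap (Fin.castAdd n p.1) (Fin.castAdd n p.2) ∘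
        Equiv.swap (Fin.natAdd n p.1) (Fin.natAdd n p.2)
        = Fin.append (u ∘ Equiv.swap p.1 p.2) (x ∘ Equiv.swap p.1 p.2) := by
      have hne : ∀ a b : Fin n, Fin.castAdd n a ≠ Fin.natAdd n b := fun a b => by
        simp [Fin.ext_iff]; omega
      funext j
      cases j using Fin.addCases with
      | left j =>
        rw [Function.comp_apply, Function.comp_apply,
          Equiv.swap_apply_of_ne_of_ne (hne j p.1) (hne j p.2),
          (Fin.castAdd_injective n n).swap_apply, Fin.append_left, Fin.append_left]
        rfl
      | right j =>
        rw [Function.comp_apply, Function.comp_apply, (Fin.natAdd_injective n n).swap_apply,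
          Equiv.swap_apply_of_ne_of_ne (hne p.1 _).symm (hne p.2 _).symm, Fin.append_right,
          Fin.append_right]
        rfl
    have hd : permOfSwaps (diagonalSwaps (p :: l)) =
        Equiv.swap (Fin.castAdd n p.1) (Fin.castAdd n p.2) *
          (Equiv.swap (Fin.natAdd n p.1) (Fin.natAdd n p.2) *
            permOfSwaps (diagonalSwaps l)) := by
      simp [permOfSwaps, diagonalSwaps]
    have hl : permOfSwaps (p :: l) = Equiv.swap p.1 p.2 * permOfSwaps l := by
      simp [permOfSwaps]
    rw [hd, hl, Equiv.Perm.coe_mul, Equiv.Perm.coe_mul, ← Function.comp_assoc,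
      ← Function.comp_assoc, Function.comp_assoc (Fin.append u x), hp, ih]
    rfl

theorem bitOf_flipAll {e : Fin n → Fin m} (he : Function.Injective e) {c : Fin n → ℕ}
    (hc : ∀ i (w w' : Fin m → Bool), w (e i) = w' (e i) →
      (∀ k, (∀ j, e j ≠ k) → w k = w' k) → bitOf (c i) w = bitOf (c i) w')
    (N : ℕ) {w w' : Fin m → Bool}
    (h : ∀ i, w' (e i) = (w (e i) ^^ bitOf (c i) w))
    (h' : ∀ k, (∀ i, e i ≠ k) → w' k = w k) :
    bitOf (flipAll e c N) w = bitOf N w' := by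
  have key : ∀ (l : List (Fin n)), l.Nodup → ∀ (N : ℕ) (w' : Fin m → Bool),
      (∀ i ∈ l, w' (e i) = (w (e i) ^^ bitOf (c i) w)) →
      (∀ k, (∀ i ∈ l, e i ≠ k) → w' k = w k) →
      bitOf (l.foldl (fun N i => condFlipTable (c i) (e i) N) N) w = bitOf N w' := by
    intro l
    induction l with
    | nil =>
      intro _ N w' _ h'
      rw [show w' = w from funext fun k => h' k (by simp)]
      rfl
    | cons i l ih =>
      intro hl N w' h h'
      obtain ⟨hi, hl⟩ := List.nodup_cons.1 hl
      have hne : ∀ j ∈ l, e j ≠ e i := fun j hj hji => hi (he hji ▸ hj)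
      rw [List.foldl_cons, ih hl _ (Function.update w' (e i) (w (e i))), bitOf_condFlipTable,
        hc i _ w]
      · rw [Function.update_self, ← h i List.mem_cons_self, Function.update_idem,
          Function.update_eq_self]
      · simp
      · intro k hk
        rw [Function.update_of_ne (hk i).symm]
        exact h' k fun j _ => hk j
      · intro j hj
        rw [Function.update_of_ne (hne j hj)]
        exact h j (List.mem_cons_of_mem _ hj)
      · intro k hk
        rcases eq_or_ne k (e i) with rfl | hki
        · simp
        · rw [Function.update_of_ne hki]
          refine h' k fun j hj => ?_
          rcases List.mem_cons.1 hj with rfl | hj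
          exacts [hki.symm, hk j hj]
  rw [flipAll, strictFoldl_eq_foldl]
  exact key _ (List.nodup_finRange n) N w' (fun i _ => h i)
    (fun k hk => h' k fun i => hk i (List.mem_finRange i))

theorem bitOf_unionTable (c : Fin n → ℕ) (w : Fin m → Bool) :
    bitOf (unionTable c) w = true ↔ ∃ i, bitOf (c i) w = true := by
  have key : ∀ (l : List (Fin n)) (N : ℕ), bitOf (l.foldl (fun N i => N ||| c i) N) w = true ↔
      bitOf N w = true ∨ ∃ i ∈ l, bitOf (c i) w = true := by
    intro l
    induction l with
    | nil => simp
    | cons i l ih => intro N; simp [ih, or_assoc]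
  rw [unionTable, strictFoldl_eq_foldl, key]
  simp

/-- A property of vectors pulled back along the given permutations holds on a saturated table as
soon as it holds on the original one. -/
theorem of_bitOf_saturate {P : (Fin m → Bool) → Prop} {L : List (List (Fin m × Fin m))}
    (hL : ∀ l ∈ L, ∀ w, P (w ∘ permOfSwaps l) → P w) {N : ℕ}
    (hN : ∀ w, bitOf N w = true → P w) {w : Fin m → Bool}
    (hw : bitOf (saturate L N) w = true) : P w := by
  rw [saturate, strictFoldl_eq_foldl] at hw
  induction L generalizing N with
  | nil => exact hN w hw
  | cons l L ih =>
    refine ih (fun l hl => hL l (List.mem_cons_of_mem _ hl)) (fun w hw => ?_) hw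
    rw [bitOf_or, Bool.or_eq_true, bitOf_permTable] at hw
    exact hw.elim (hN w) fun h => hL l List.mem_cons_self w (hN _ h)

theorem bitOf_reflectTable (N : ℕ) (u x : Fin n → Bool) :
    bitOf (reflectTable n N) (Fin.append u x) = bitOf N (Fin.append (fun i => u i ^^ x i) x) := by
  apply bitOf_flipAll (Fin.castAdd_injective n n)
  · intro i w w' _ h
    simpa only [bitOf_coordTable] using h _ fun j => by simp [Fin.ext_iff]; omega
  · simp only [bitOf_coordTable, Fin.append_left, Fin.append_right, implies_true]
  · intro k hk
    cases k using Fin.addCases with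
    | left i => exact absurd rfl (hk i)
    | right i => simp only [Fin.append_right]

theorem bitOf_translateLeft (y : Fin n → Bool) (N : ℕ) (u x : Fin n → Bool) :
    bitOf (translateLeft y N) (Fin.append u x) =
      bitOf N (Fin.append (fun i => u i ^^ y i) x) := by
  apply bitOf_flipAll (Fin.castAdd_injective n n)
  · simp
  · simp
  · intro k hk
    cases k using Fin.addCases with
    | left i => exact absurd rfl (hk i)
    | right i => simp only [Fin.append_right]

theorem bitOf_translateRight (y : Fin n → Bool) (N : ℕ) (u x : Fin n → Bool) :
    bitOf (translateRight y N) (Fin.append u x) =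
      bitOf N (Fin.append u (fun i => x i ^^ y i)) := by
  apply bitOf_flipAll (Fin.natAdd_injective n n)
  · simp
  · simp only [bitOf_constTable, Fin.append_right, implies_true]
  · intro k hk
    cases k using Fin.addCases with
    | left i => simp
    | right i => exact absurd rfl (hk i)

theorem bitOf_restrictRight (y : Fin n → Bool) (N : ℕ) (u x : Fin n → Bool) :
    bitOf (restrictRight y N) (Fin.append u x) = bitOf N (Fin.append u y) := by
  apply bitOf_flipAll (Fin.natAdd_injective n n)
  · intro i w w' h _
    simp only [bitOf_xor, bitOf_coordTable, bitOf_constTable, h]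
  · intro i
    simp only [bitOf_xor, bitOf_coordTable, bitOf_constTable, Fin.append_right]
    cases x i <;> simp
  · intro k hk
    cases k using Fin.addCases with
    | left i => simp
    | right i => exact absurd rfl (hk i)

theorem bitOf_disjointTable {y u x : Fin n → Bool} (hx : ∃ i, x i = true)
    (hxy : ∀ i, ¬(x i = true ∧ y i = true)) :
    bitOf (disjointTable y) (Fin.append u x) = true := by
  have h : bitOf (unionTable fun i : Fin n => coordTable (n + n) (Fin.natAdd n i) &&&
      constTable (n + n) (y i)) (Fin.append u x) = false := by
    rw [← Bool.not_eq_true, bitOf_unionTable]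
    simpa only [bitOf_and, bitOf_coordTable, bitOf_constTable, Fin.append_right,
      Bool.and_eq_true, not_exists] using hxy
  rw [disjointTable, bitOf_muxTable, h]
  simpa only [Bool.false_eq_true, if_false, bitOf_unionTable, bitOf_coordTable,
    Fin.append_right] using hx

end

/-- No rectangle with one side in direction `y` is monochromatic for the colouring
`(u, u + x) ↦ N (u, x)`. -/
def NoMonoRectangle {n : ℕ} (N : ℕ) (y : Fin n → Bool) : Prop :=
  ∀ u x : Fin n → Bool, (∃ i, x i = true) → (∀ i, ¬(x i = true ∧ y i = true)) →
    ∀ b, ¬(bitOf N (Fin.append u x) = b ∧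
      bitOf N (Fin.append (fun i => u i ^^ y i) x) = b ∧
      bitOf N (Fin.append u fun i => x i ^^ y i) = b ∧
      bitOf N (Fin.append (fun i => u i ^^ y i) fun i => x i ^^ y i) = b ∧
      bitOf N (Fin.append u y) = b ∧
      bitOf N (Fin.append (fun i => u i ^^ x i) y) = b)

theorem noMonoRectangle_of_rectangleCheck {n N : ℕ} {y : Fin n → Bool}
    (h : rectangleCheck N y = true) : NoMonoRectangle N y := by
  simp only [rectangleCheck, withValue_eq, Bool.and_eq_true] at h
  have h0 := Nat.eq_of_beq_eq_true h.1
  have h1 := Nat.eq_of_beq_eq_true h.2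
  intro u x hx hxy b
  have e0 := congrArg (fun M => bitOf M (Fin.append u x)) h0
  have e1 := congrArg (fun M => bitOf M (Fin.append u x)) h1
  simp only [bitOf_and, bitOf_or, bitOf_disjointTable hx hxy, bitOf_translateLeft,
    bitOf_translateRight, bitOf_restrictRight, bitOf_reflectTable, bitOf_zero,
    Bool.true_and] at e0 e1
  rintro ⟨h1, h2, h3, h4, h5, h6⟩
  rw [h1, h2, h3, h4, h5, h6] at e0 e1
  cases b <;> simp at e0 e1

/-- Three distinct vertices of the cube are affinely independent. -/
theorem eq_zero_of_weight_eq_zero {n : ℕ} {b d e : Fin n → Bool} {r s t : ℝ}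
    (hbd : b ≠ d) (hbe : b ≠ e) (hde : d ≠ e) (hsum : r + s + t = 0)
    (h : ∀ i, r * toPoint n b i + s * toPoint n d i + t * toPoint n e i = 0) :
    r = 0 ∧ s = 0 ∧ t = 0 := by
  have sep : ∀ {b d e : Fin n → Bool} {r s t : ℝ}, b ≠ d → r + s + t = 0 →
      (∀ i, r * toPoint n b i + s * toPoint n d i + t * toPoint n e i = 0) →
      r = 0 ∨ s = 0 := by
    intro b d e r s t hbd hsum h
    obtain ⟨i, hi⟩ := Function.ne_iff.1 hbd
    have hi' := h i
    simp only [toPoint] at hi'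
    cases hb : b i <;> cases hd : d i <;> cases he : e i <;> simp [hb, hd, he] at hi hi'
    · exact Or.inr hi'
    · exact Or.inl (by linarith)
    · exact Or.inl hi'
    · exact Or.inr (by linarith)
  have h1 := sep hbd hsum h
  have h2 := sep (b := b) (d := e) (e := d) (r := r) (s := t) (t := s) hbe
    (by linarith) fun i => by linarith [h i]
  have h3 := sep (b := d) (d := e) (e := b) (r := s) (s := t) (t := r) hde
    (by linarith) fun i => by linarith [h i]
  rcases h1 with h1 | h1 <;> rcases h2 with h2 | h2 <;> rcases h3 with h3 | h3 <;>
    refine ⟨?_, ?_, ?_⟩ <;> linarith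

/-- `r` is the vertex opposite to `a` in the rectangle with sides `a p` and `a q`. -/
def IsRectangle {n : ℕ} (a p q r : Fin n → Bool) : Prop :=
  ∀ i, (a i = p i ∨ a i = q i) ∧ r i = (a i ^^ p i ^^ q i)

theorem isRectangle_of_coplanar {n : ℕ} {a b d e : Fin n → Bool}
    (hab : a ≠ b) (had : a ≠ d) (hae : a ≠ e) (hbd : b ≠ d) (hbe : b ≠ e) (hde : d ≠ e)
    (h : Coplanar ℝ ({toPoint n a, toPoint n b, toPoint n d, toPoint n e} : Set (Fin n → ℝ))) :
    IsRectangle a b d e ∨ IsRectangle a b e d ∨ IsRectangle a d e b := by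
  have hdep : ¬AffineIndependent ℝ ![toPoint n a, toPoint n b, toPoint n d, toPoint n e] := by
    rw [affineIndependent_iff_not_finrank_vectorSpan_le ℝ _ (n := 2) (by simp), not_not]
    rw [coplanar_iff_finrank_le_two] at h
    have hrange : Set.range ![toPoint n a, toPoint n b, toPoint n d, toPoint n e] =
        {toPoint n a, toPoint n b, toPoint n d, toPoint n e} := by
      simp_rw [Matrix.range_cons, Matrix.range_empty, Set.singleton_union, insert_empty_eq]
    rwa [hrange]
  rw [affineIndependent_iff_of_fintype] at hdep
  push Not at hdep
  obtain ⟨w, hw, hp, hne⟩ := hdep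
  rw [Finset.weightedVSub_eq_linear_combination _ hw] at hp
  have hsum : w 0 + w 1 + w 2 + w 3 = 0 := by simpa [Fin.sum_univ_four] using hw
  have hcoord : ∀ i, w 0 * toPoint n a i + w 1 * toPoint n b i + w 2 * toPoint n d i +
      w 3 * toPoint n e i = 0 := fun i => by
    simpa [Fin.sum_univ_four] using congrFun hp i
  have hnz : ¬(w 0 = 0 ∧ w 1 = 0 ∧ w 2 = 0 ∧ w 3 = 0) := by
    rintro ⟨h0, h1, h2, h3⟩
    obtain ⟨i, hi⟩ := hne
    fin_cases i <;> contradiction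
  have h0 : w 0 ≠ 0 := fun h0 => hnz ⟨h0, eq_zero_of_weight_eq_zero hbd hbe hde
    (by linarith) fun i => by have := hcoord i; rw [h0] at this; linarith⟩
  have h1 : w 1 ≠ 0 := fun h1 => by
    have := eq_zero_of_weight_eq_zero had hae hde (r := w 0) (s := w 2) (t := w 3)
      (by linarith) fun i => by have := hcoord i; rw [h1] at this; linarith
    exact h0 this.1
  have h2 : w 2 ≠ 0 := fun h2 => by
    have := eq_zero_of_weight_eq_zero hab hae hbe (r := w 0) (s := w 1) (t := w 3)
      (by linarith) fun i => by have := hcoord i; rw [h2] at this; linarith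
    exact h0 this.1
  have h3 : w 3 ≠ 0 := fun h3 => by
    have := eq_zero_of_weight_eq_zero hab had hbd (r := w 0) (s := w 1) (t := w 2)
      (by linarith) fun i => by have := hcoord i; rw [h3] at this; linarith
    exact h0 this.1
  have key : ∀ i, (a i = b i ∧ d i = e i ∧ (a i = d i ∨ w 0 + w 1 = 0)) ∨
      (a i = d i ∧ b i = e i ∧ w 0 + w 2 = 0) ∨ (a i = e i ∧ b i = d i ∧ w 0 + w 3 = 0) := by
    intro i
    have hi := hcoord i
    simp only [toPoint] at hi
    cases ha : a i <;> cases hb : b i <;> cases hd : d i <;> cases he : e i <;>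
      simp [ha, hb, hd, he, h0, h1, h2, h3] at hi ⊢ <;> first
        | linarith
        | exact h0 (by linarith)
        | exact h1 (by linarith)
        | exact h2 (by linarith)
        | exact h3 (by linarith)
  by_cases h01 : w 0 + w 1 = 0
  · by_cases h02 : w 0 + w 2 = 0
    · have h03 : w 0 + w 3 ≠ 0 := fun h => h0 (by linarith)
      refine Or.inl fun i => ?_
      have := key i
      cases ha : a i <;> cases hb : b i <;> cases hd : d i <;> cases he : e i <;>
        simp_all
    · refine Or.inr (Or.inl fun i => ?_)
      have := key i
      cases ha : a i <;> cases hb : b i <;> cases hd : d i <;> cases he : e i <;>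
        simp_all
  · refine Or.inr (Or.inr fun i => ?_)
    have := key i
    cases ha : a i <;> cases hb : b i <;> cases hd : d i <;> cases he : e i <;>
      simp_all

theorem NoMonoRectangle.of_comp {n N : ℕ} {σ : Equiv.Perm (Fin n)}
    (hσ : ∀ u x : Fin n → Bool,
      bitOf N (Fin.append (u ∘ σ) (x ∘ σ)) = bitOf N (Fin.append u x))
    {y : Fin n → Bool} (h : NoMonoRectangle N (y ∘ σ)) : NoMonoRectangle N y := by
  rintro u x ⟨i, hi⟩ hxy b ⟨h1, h2, h3, h4, h5, h6⟩
  refine h (u ∘ σ) (x ∘ σ) ⟨σ.symm i, by simpa using hi⟩ (fun j => hxy (σ j)) b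
    ⟨?_, ?_, ?_, ?_, ?_, ?_⟩
  · exact (hσ _ _).trans h1
  · exact (hσ (fun i => u i ^^ y i) x).trans h2
  · exact (hσ u fun i => x i ^^ y i).trans h3
  · exact (hσ (fun i => u i ^^ y i) fun i => x i ^^ y i).trans h4
  · exact (hσ u y).trans h5
  · exact (hσ (fun i => u i ^^ x i) y).trans h6

theorem bitOf_append_comp {n N : ℕ} {l : List (Fin n × Fin n)}
    (h : Nat.beq (permTable (diagonalSwaps l) N) N = true) (u x : Fin n → Bool) :
    bitOf N (Fin.append (u ∘ permOfSwaps l) (x ∘ permOfSwaps l)) =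
      bitOf N (Fin.append u x) := by
  rw [← append_comp_permOfSwaps, ← bitOf_permTable, Nat.eq_of_beq_eq_true h]

theorem exists_mem_directionRows {w : Fin 10 → Bool} (h : bitOf representatives w = true) :
    ∃ r ∈ directionRows, w = fun i : Fin 10 => r.1.testBit i := by
  have key : ∀ (l : List (ℕ × ℕ)) (N k : ℕ),
      (l.foldl (fun N r => N ||| 1 <<< r.1) N).testBit k = true →
      N.testBit k = true ∨ ∃ r ∈ l, k = r.1 := by
    intro l
    induction l with
    | nil => intro N k h; exact Or.inl h
    | cons r l ih =>
      intro N k h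
      rcases ih _ _ h with h | ⟨r, hr, hk⟩
      · rw [Nat.testBit_or, Nat.one_shiftLeft, Nat.testBit_two_pow, Bool.or_eq_true,
          decide_eq_true_eq] at h
        exact h.imp id fun h => ⟨r, List.mem_cons_self, h.symm⟩
      · exact Or.inr ⟨r, List.mem_cons_of_mem _ hr, hk⟩
  rw [bitOf, representatives, strictFoldl_eq_foldl] at h
  rcases key _ _ _ h with h | ⟨r, hr, hk⟩
  · simp at h
  · exact ⟨r, hr, funext fun i => by rw [← hk]; simp⟩

theorem bitOf_saturate_representatives {y : Fin 10 → Bool} (hy : ∃ i, y i = true) :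
    bitOf (saturate saturationWord representatives) y = true := by
  obtain ⟨i, hi⟩ := hy
  have hlt := Nat.ofBits_lt_two_pow y
  have hpos : Nat.ofBits y ≠ 0 := fun h => by
    have := Nat.testBit_ofBits_lt y i.val i.isLt
    simp [h, hi] at this
  obtain ⟨k, hk⟩ := Nat.exists_eq_succ_of_ne_zero hpos
  rw [saturate_representatives, bitOf, hk,
    show 2 ^ 2 ^ 10 - 2 = 2 * (2 ^ 1023 - 1) by decide +kernel, Nat.succ_eq_add_one,
    Nat.testBit_succ, Nat.mul_div_cancel_left _ two_pos, Nat.testBit_two_pow_sub_one,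
    decide_eq_true_eq]
  omega

theorem swaps_eq {l : List (Fin 10 × Fin 10)} (hl : l ∈ saturationWord) :
    l = swaps1 ∨ l = swaps2 := by
  simp only [saturationWord, List.mem_cons, List.not_mem_nil] at hl
  tauto

theorem bitOf_colourTable_comp {l : List (Fin 10 × Fin 10)} (hl : l = swaps1 ∨ l = swaps2)
    (u x : Fin 10 → Bool) :
    bitOf colourTable (Fin.append (u ∘ permOfSwaps l) (x ∘ permOfSwaps l)) =
      bitOf colourTable (Fin.append u x) := by
  have h := tableCheck_colourTable
  rw [withValue_eq] at h
  simp only [tableCheck, Bool.and_eq_true] at h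
  rcases hl with rfl | rfl
  exacts [bitOf_append_comp h.1.1.1 u x, bitOf_append_comp h.1.1.2 u x]

theorem bitOf_colourTable_reflect (u x : Fin 10 → Bool) :
    bitOf colourTable (Fin.append (fun i => u i ^^ x i) x) =
      bitOf colourTable (Fin.append u x) := by
  have h := tableCheck_colourTable
  rw [withValue_eq] at h
  simp only [tableCheck, Bool.and_eq_true] at h
  rw [← bitOf_reflectTable, Nat.eq_of_beq_eq_true h.1.2]

theorem noMonoRectangle_colourTable {y : Fin 10 → Bool} (hy : ∃ i, y i = true) :
    NoMonoRectangle colourTable y := by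
  have h := tableCheck_colourTable
  rw [withValue_eq] at h
  simp only [tableCheck, Bool.and_eq_true] at h
  refine of_bitOf_saturate
    (fun l hl w => NoMonoRectangle.of_comp (bitOf_colourTable_comp (swaps_eq hl)))
    (fun w hw => ?_) (bitOf_saturate_representatives hy)
  obtain ⟨r, hr, rfl⟩ := exists_mem_directionRows hw
  exact noMonoRectangle_of_rectangleCheck (List.all_eq_true.1 h.2 r hr)

/-- The colouring of the edges of `K(C_10)` with table `colourTable`. -/
def tableColouring : Sym2 (Fin 10 → Bool) → Bool :=
  Sym2.lift ⟨fun u v => bitOf colourTable (Fin.append u fun i => u i ^^ v i), fun u v => by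
    change bitOf colourTable _ = bitOf colourTable _
    rw [← bitOf_colourTable_reflect]
    congr! 2
    · funext i; cases u i <;> simp
    · funext i; exact Bool.xor_comm _ _⟩

theorem bitOf_colourTable_eq {u v w x : Fin 10 → Bool} (hu : ∀ i, w i = u i)
    (hx : ∀ i, x i = (u i ^^ v i)) :
    bitOf colourTable (Fin.append w x) = tableColouring s(u, v) := by
  obtain rfl : w = u := funext hu
  obtain rfl : x = _ := funext hx
  rfl

theorem not_mono_of_isRectangle {a p q r : Fin 10 → Bool} (hap : a ≠ p) (haq : a ≠ q)
    (h : IsRectangle a p q r) (b : Bool) :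
    ¬(tableColouring s(a, p) = b ∧ tableColouring s(a, q) = b ∧ tableColouring s(a, r) = b ∧
      tableColouring s(p, q) = b ∧ tableColouring s(p, r) = b ∧
      tableColouring s(q, r) = b) := by
  have hne : ∀ {v : Fin 10 → Bool}, a ≠ v → ∃ i, (a i ^^ v i) = true := fun {v} hv => by
    simpa [Function.ne_iff] using hv
  rintro ⟨h1, h2, h3, h4, h5, h6⟩
  refine noMonoRectangle_colourTable (hne haq) a (fun i => a i ^^ p i) (hne hap) (fun i => ?_) b
    ⟨h1, (bitOf_colourTable_eq (fun i => ?_) fun i => ?_).trans h6,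
      (bitOf_colourTable_eq (fun i => ?_) fun i => ?_).trans h3,
      (bitOf_colourTable_eq (fun i => ?_) fun i => ?_).trans (Sym2.eq_swap ▸ h4), h2,
      (bitOf_colourTable_eq (fun i => ?_) fun i => ?_).trans h5⟩ <;>
    rcases h i with ⟨h | h, hr⟩ <;> simp only [h, hr] <;> cases p i <;> cases q i <;>
    decide

theorem noMonoPlanarK4_tableColouring : NoMonoPlanarK4 10 tableColouring := by
  rintro a b d e hab had hae hbd hbe hde h ⟨h1, h2, h3, h4, h5⟩
  have hdb := Sym2.eq_swap (a := d) (b := b)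
  have heb := Sym2.eq_swap (a := e) (b := b)
  have hed := Sym2.eq_swap (a := e) (b := d)
  rcases isRectangle_of_coplanar hab had hae hbd hbe hde h with h | h | h
  · exact not_mono_of_isRectangle hab had h _ ⟨rfl, h1.symm, h2.symm, h3.symm, h4.symm, h5.symm⟩
  · exact not_mono_of_isRectangle hab hae h _
      ⟨rfl, h2.symm, h1.symm, h4.symm, h3.symm, by rw [hed, h5]⟩
  · exact not_mono_of_isRectangle had hae h _
      ⟨h1.symm, h2.symm, rfl, h5.symm, by rw [hdb, h3], by rw [heb, h4]⟩

theorem g1_eq : g1 = permOfSwaps swaps1 := by decide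

theorem g2_eq : g2 = permOfSwaps swaps2 := by decide

theorem tableColouring_comp {l : List (Fin 10 × Fin 10)} (hl : l = swaps1 ∨ l = swaps2)
    (u v : Fin 10 → Bool) :
    tableColouring s(u ∘ permOfSwaps l, v ∘ permOfSwaps l) = tableColouring s(u, v) :=
  bitOf_colourTable_comp hl u fun i => u i ^^ v i

theorem invariantUnder_tableColouring :
    InvariantUnder 10 (Subgroup.closure {g1, g2}) tableColouring := by
  have key : ∀ σ ∈ Subgroup.closure {g1, g2}, ∀ u v : Fin 10 → Bool,
      tableColouring s(u ∘ σ, v ∘ σ) = tableColouring s(u, v) := by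
    intro σ hσ
    induction hσ using Subgroup.closure_induction with
    | mem σ hσ =>
      rcases hσ with rfl | rfl
      · rw [g1_eq]; exact tableColouring_comp (Or.inl rfl)
      · rw [g2_eq]; exact tableColouring_comp (Or.inr rfl)
    | one => exact fun u v => rfl
    | mul σ τ _ _ hσ hτ => exact fun u v => (hτ (u ∘ σ) (v ∘ σ)).trans (hσ u v)
    | inv σ _ hσ =>
      intro u v
      rw [← hσ]
      simp only [Function.comp_assoc, ← Equiv.Perm.coe_mul, inv_mul_cancel]
      rfl
  exact fun σ hσ u v _ => key σ⁻¹ (inv_mem hσ) u v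

theorem exists_S5_invariant_good_colouring_C10 :
    ∃ c : Sym2 (Fin 10 → Bool) → Bool, NoMonoPlanarK4 10 c ∧
      InvariantUnder 10 (Subgroup.closure {g1, g2}) c :=
  ⟨tableColouring, noMonoPlanarK4_tableColouring, invariantUnder_tableColouring⟩
end
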